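/- arXiv:2302.05537 — 2 statements merged into one kernel-verified Lean document; each statement's English description precedes it below -/
import Mathlib

section
/- There is an absolute constant C ≥ 1 such that the following holds. Let F be a finite field with q elements, n ≥ 1, and let A ⊆ 𝔽_q^n satisfy |A| ≥ 2^{−d}·q^n for some real d ≥ 1. Then the number of triples (x, y, z) ∈ A³ with x + y = 2·z is at least q^{−C·d^9} · q^{2n}. -/
theorem Submodule.exists_finrank_le_card_support {K B : Type*} [Field K] [DecidableEq K]
    [Fintype B] (W : Submodule K (B → K)) :
    ∃ w ∈ W, Module.finrank K W ≤ Fintype.card {i // w i ≠ 0} := by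
  obtain ⟨w, hw, hmax⟩ : ∃ w ∈ W, ∀ v ∈ W,
      Fintype.card {i // v i ≠ 0} ≤ Fintype.card {i // w i ≠ 0} := by
    have hb : BddAbove ((fun v : B → K => Fintype.card {i // v i ≠ 0}) '' W) :=
      ⟨Fintype.card B, by rintro _ ⟨v, -, rfl⟩; exact Fintype.card_subtype_le _⟩
    obtain ⟨w, hw, h⟩ := Nat.sSup_mem (Set.Nonempty.image _ ⟨0, W.zero_mem⟩) hb
    exact ⟨w, hw, fun v hv => (le_csSup hb ⟨v, hv, rfl⟩).trans h.ge⟩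
  refine ⟨w, hw, ?_⟩
  rw [← Module.finrank_fintype_fun_eq_card K]
  refine LinearMap.finrank_le_finrank_of_injective
    (f := LinearMap.funLeft K K (Subtype.val : {i // w i ≠ 0} → B) ∘ₗ W.subtype) ?_
  rw [← LinearMap.ker_eq_bot, LinearMap.ker_eq_bot']
  rintro ⟨v, hv⟩ h
  have hvan : ∀ i, w i ≠ 0 → v i = 0 := fun i hi => congrFun h ⟨i, hi⟩
  by_contra hne
  obtain ⟨j, hj⟩ : ∃ j, v j ≠ 0 := by
    by_contra! h0
    exact hne (Subtype.ext (funext h0))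
  have hwj : w j = 0 := by
    by_contra h0
    exact hj (hvan j h0)
  refine (hmax (w + v) (W.add_mem hw hv)).not_gt ?_
  simp only [Fintype.card_subtype]
  refine Finset.card_lt_card ((Finset.ssubset_iff_of_subset ?_).2 ⟨j, ?_, ?_⟩)
  · intro i hi
    simp only [Finset.mem_filter, Finset.mem_univ, true_and] at hi
    simp [hvan i hi, hi]
  · simp [hwj, hj]
  · simp [hwj]

theorem card_support_le_of_diagonal_eq {K B I : Type*} [Field K] [DecidableEq K] [Fintype B]
    [DecidableEq B] [Fintype I] (w : B → K) (u : I → B → K) (f g : I → B → K)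
    (H : ∀ x y, (if x = y then w x else 0) = ∑ i, u i x * f i y + ∑ i, u i y * g i x) :
    Fintype.card {x // w x ≠ 0} ≤ 2 * Fintype.card I := by
  have hM : Matrix.diagonal w =
      (Matrix.of fun x (s : I ⊕ I) => Sum.elim (fun i => u i x) (fun i => g i x) s) *
        (Matrix.of fun (s : I ⊕ I) y => Sum.elim (fun i => f i y) (fun i => u i y) s) := by
    ext x y
    simp [Matrix.diagonal_apply, H, Matrix.mul_apply, Fintype.sum_sum_type, mul_comm]
  rw [← Matrix.rank_diagonal, hM]
  refine (Matrix.rank_mul_le_left _ _).trans ((Matrix.rank_le_card_width _).trans ?_)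
  simp [two_mul]

theorem card_le_of_diagonal_tensor_eq {K B I : Type*} [Field K] [Fintype B] [DecidableEq B]
    [Fintype I] (u : I → B → K) (f g h : I → B → B → K)
    (H : ∀ x y z, (if x = y ∧ y = z then 1 else 0) =
      ∑ i, u i x * f i y z + ∑ i, u i y * g i x z + ∑ i, u i z * h i x y) :
    Fintype.card B ≤ 3 * Fintype.card I := by
  classical
  let L : (B → K) →ₗ[K] (I → K) := Matrix.toLin' (Matrix.of u)
  obtain ⟨w, hw, hcard⟩ := (LinearMap.ker L).exists_finrank_le_card_support
  have hrank := L.finrank_range_add_finrank_ker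
  have hrange := (LinearMap.range L).finrank_le
  rw [Module.finrank_fintype_fun_eq_card] at hrank hrange
  have hw0 : ∀ i, ∑ z, u i z * w z = 0 := fun i => congrFun (LinearMap.mem_ker.1 hw) i
  have := card_support_le_of_diagonal_eq w u (fun i y => ∑ z, f i y z * w z)
    (fun i x => ∑ z, g i x z * w z) (fun x y => by
      calc (if x = y then w x else 0) = ∑ z, (if x = y ∧ y = z then 1 else 0) * w z := by
            by_cases hxy : x = y <;> simp [hxy]
        _ = ∑ i, u i x * ∑ z, f i y z * w z + ∑ i, u i y * ∑ z, g i x z * w z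
              + ∑ i, h i x y * ∑ z, u i z * w z := by
            simp only [H, add_mul, Finset.sum_add_distrib, Finset.sum_mul, Finset.mul_sum]
            congr 1
            · congr 1 <;> rw [Finset.sum_comm] <;> simp only [mul_assoc]
            · rw [Finset.sum_comm]
              simp only [mul_assoc, mul_left_comm]
        _ = _ := by simp [hw0])
  omega

/-- Exponent vectors in `[0, k]^m` whose degree is at most a third of the maximum `k * m`. -/
def lowDegreeExponents (k m : ℕ) : Finset (Fin m → ℕ) :=
  (Fintype.piFinset fun _ => Finset.range (k + 1)).filter fun a => 3 * ∑ t, a t ≤ k * m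

theorem card_lowDegreeExponents_le {k : ℕ} (hk : 1 ≤ k) (m : ℕ) :
    ((lowDegreeExponents k m).card : ℝ) ≤ (945 / 1000 * (k + 1)) ^ m := by
  have hk0 : (0 : ℝ) < k := by exact_mod_cast hk
  let g : ℕ → ℝ := fun j => (64 / 125 : ℝ) ^ ((j : ℝ) / k)
  have hg : ∀ j, 0 ≤ g j := fun j => by positivity
  have hsum : ∑ j ∈ Finset.range (k + 1), g j ≤ 4 / 5 * (945 / 1000 * (k + 1)) := by
    calc ∑ j ∈ Finset.range (k + 1), g j
        ≤ ∑ j ∈ Finset.range (k + 1), (1 - 61 / 125 / k * (j : ℝ)) := by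
          refine Finset.sum_le_sum fun j hj => ?_
          have hj : (j : ℝ) ≤ k := by exact_mod_cast Nat.lt_succ_iff.1 (Finset.mem_range.1 hj)
          have := rpow_one_add_le_one_add_mul_self (s := -(61 / 125)) (by norm_num)
            (p := (j : ℝ) / k) (by positivity) ((div_le_one hk0).2 hj)
          norm_num at this
          have hlin : (j : ℝ) / k * (61 / 125) = 61 / 125 / k * j := by ring
          change (64 / 125 : ℝ) ^ ((j : ℝ) / k) ≤ _
          linarith
      _ = 4 / 5 * (945 / 1000 * (k + 1)) := by
          have hid : (∑ j ∈ Finset.range (k + 1), (j : ℝ)) * 2 = (k + 1) * k := by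
            have := Finset.sum_range_id_mul_two (k + 1)
            rw [Nat.add_sub_cancel] at this
            have := congrArg (Nat.cast (R := ℝ)) this
            push_cast at this
            exact this
          rw [Finset.sum_sub_distrib, ← Finset.mul_sum,
            eq_div_of_mul_eq two_ne_zero hid]
          simp
          field_simp
          ring
  have hlow : ∀ a ∈ lowDegreeExponents k m, (4 / 5 : ℝ) ^ m ≤ ∏ t, g (a t) := by
    intro a ha
    have ha : (3 : ℝ) * ∑ t, (a t : ℝ) ≤ k * m := by
      exact_mod_cast (Finset.mem_filter.1 ha).2
    rw [← Real.rpow_sum_of_pos (by norm_num), ← Finset.sum_div,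
      show (64 / 125 : ℝ) = (4 / 5) ^ (3 : ℝ) by norm_num, ← Real.rpow_mul (by norm_num),
      ← Real.rpow_natCast]
    refine Real.rpow_le_rpow_of_exponent_ge (by norm_num) (by norm_num) ?_
    rw [← mul_div_assoc, div_le_iff₀ hk0]
    linarith
  have : (4 / 5 : ℝ) ^ m * (lowDegreeExponents k m).card ≤
      (4 / 5) ^ m * (945 / 1000 * (k + 1)) ^ m := by
    calc (4 / 5 : ℝ) ^ m * (lowDegreeExponents k m).card
        = ∑ a ∈ lowDegreeExponents k m, (4 / 5 : ℝ) ^ m := by simp [mul_comm]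
      _ ≤ ∑ a ∈ lowDegreeExponents k m, ∏ t, g (a t) := Finset.sum_le_sum hlow
      _ ≤ ∑ a ∈ Fintype.piFinset fun _ : Fin m => Finset.range (k + 1), ∏ t, g (a t) :=
          Finset.sum_le_sum_of_subset_of_nonneg (Finset.filter_subset _ _)
            fun a _ _ => Finset.prod_nonneg fun t _ => hg _
      _ = (∑ j ∈ Finset.range (k + 1), g j) ^ m := by
          rw [← Finset.prod_univ_sum]
          simp
      _ ≤ _ := by
          rw [← mul_pow]
          exact pow_le_pow_left₀ (Finset.sum_nonneg fun j _ => hg j) hsum m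
  exact le_of_mul_le_mul_left this (by positivity)

theorem exists_expansion_one_sub_pow {K : Type*} [Field K] {k : ℕ} (hk : 1 ≤ k) :
    ∃ (S : Finset (Fin 3 → ℕ)) (c : (Fin 3 → ℕ) → K), (∀ p ∈ S, p 0 + p 1 + p 2 ≤ k) ∧
      ∀ x y z : K, 1 - (x + y - (z + z)) ^ k =
        ∑ p ∈ S, c p * (x ^ p 0 * y ^ p 1 * z ^ p 2) := by
  have h0 : (0 : Fin 3 → ℕ) ∉ Finset.piAntidiag Finset.univ k := by
    simp only [Finset.mem_piAntidiag]
    rintro ⟨h, -⟩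
    simp at h
    omega
  refine ⟨insert 0 (Finset.piAntidiag Finset.univ k),
    fun p => if p = 0 then 1 else -((Nat.multinomial Finset.univ p : K) * (-2) ^ p 2), ?_, ?_⟩
  · intro p hp
    rcases Finset.mem_insert.1 hp with rfl | hp
    · simp
    · have := (Finset.mem_piAntidiag.1 hp).1
      simp only [Fin.sum_univ_three] at this
      omega
  · intro x y z
    rw [Finset.sum_insert h0]
    have := Finset.sum_pow_eq_sum_piAntidiag Finset.univ ![x, y, -2 * z] k
    simp only [Fin.sum_univ_three, Fin.prod_univ_three] at this
    rw [show x + y - (z + z) = ![x, y, -2 * z] 0 + ![x, y, -2 * z] 1 + ![x, y, -2 * z] 2 by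
      simp; ring, this, sub_eq_add_neg, ← Finset.sum_neg_distrib]
    congr 1
    · simp
    · refine Finset.sum_congr rfl fun p hp => ?_
      beta_reduce
      rw [if_neg (ne_of_mem_of_not_mem hp h0)]
      simp
      ring

theorem card_le_of_forall_add_eq_imp_eq {F : Type*} [Field F] [Fintype F] [DecidableEq F]
    (h2 : (2 : F) ≠ 0) {m : ℕ} (B : Finset (Fin m → F))
    (hB : ∀ x ∈ B, ∀ y ∈ B, ∀ z ∈ B, x + y = z + z → x = y) :
    B.card ≤ 3 * (lowDegreeExponents (Fintype.card F - 1) m).card := by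
  set k := Fintype.card F - 1 with hkdef
  have hk : 1 ≤ k := by
    have := Fintype.one_lt_card (α := F)
    omega
  obtain ⟨S, c, hS, hc⟩ := exists_expansion_one_sub_pow (K := F) hk
  let I := lowDegreeExponents k m
  let u : (Fin m → ℕ) → (Fin m → F) → F := fun a x => ∏ t, x t ^ a t
  let e : Fin 3 → (Fin m → Fin 3 → ℕ) → (Fin m → ℕ) := fun j P t => P t j
  let Q := Fintype.piFinset fun _ : Fin m => S
  let C : (Fin m → Fin 3 → ℕ) → F := fun P => ∏ t, c (P t)
  have hexp : ∀ x y z : Fin m → F, (if x + y = z + z then (1 : F) else 0) =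
      ∑ P ∈ Q, C P * (u (e 0 P) x * u (e 1 P) y * u (e 2 P) z) := by
    intro x y z
    calc (if x + y = z + z then (1 : F) else 0)
        = ∏ t, (1 - (x t + y t - (z t + z t)) ^ k) := by
          split_ifs with h
          · refine (Finset.prod_eq_one fun t _ => ?_).symm
            have : x t + y t = z t + z t := congrFun h t
            rw [this, sub_self, zero_pow (by omega), sub_zero]
          · obtain ⟨t, ht⟩ : ∃ t, x t + y t ≠ z t + z t := by
              by_contra! h'
              exact h (funext h')
            refine (Finset.prod_eq_zero (Finset.mem_univ t) ?_).symm
            rw [FiniteField.pow_card_sub_one_eq_one _ (sub_ne_zero.2 ht), sub_self]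
      _ = _ := by
          simp only [hc, Finset.prod_univ_sum, Finset.prod_mul_distrib]
          rfl
  have hlow : ∀ P ∈ Q, ∀ j, 3 * ∑ t, e j P t ≤ k * m → e j P ∈ I := by
    intro P hP j hj
    refine Finset.mem_filter.2 ⟨Fintype.mem_piFinset.2 fun t => Finset.mem_range.2 ?_, hj⟩
    have := hS _ (Fintype.mem_piFinset.1 hP t)
    fin_cases j <;> simp [e] <;> omega
  have hsome : ∀ P ∈ Q, e 0 P ∉ I → e 1 P ∉ I → e 2 P ∈ I := by
    intro P hP h0 h1
    have h0 := mt (hlow P hP 0) h0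
    have h1 := mt (hlow P hP 1) h1
    refine hlow P hP 2 ?_
    have : ∑ t, e 0 P t + ∑ t, e 1 P t + ∑ t, e 2 P t ≤ k * m := by
      rw [← Finset.sum_add_distrib, ← Finset.sum_add_distrib, mul_comm]
      refine (Finset.sum_le_card_nsmul _ _ k fun t _ =>
        hS _ (Fintype.mem_piFinset.1 hP t)).trans ?_
      simp
    omega
  let Q₀ := Q.filter fun P => e 0 P ∈ I
  let Q₁ := (Q.filter fun P => e 0 P ∉ I).filter fun P => e 1 P ∈ I
  let Q₂ := (Q.filter fun P => e 0 P ∉ I).filter fun P => e 1 P ∉ I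
  have hgroup : ∀ (R : Finset (Fin m → Fin 3 → ℕ)) (j : Fin 3), (∀ P ∈ R, e j P ∈ I) →
      ∀ (x : Fin m → F) (w : (Fin m → Fin 3 → ℕ) → F),
      ∑ P ∈ R, u (e j P) x * w P =
        ∑ i : I, u i x * ∑ P ∈ R.filter fun P => e j P = i, w P := by
    intro R j hR x w
    rw [← Finset.sum_fiberwise_of_maps_to hR, ← Finset.sum_coe_sort I]
    refine Finset.sum_congr rfl fun i _ => ?_
    rw [Finset.mul_sum]
    refine Finset.sum_congr rfl fun P hP => ?_
    rw [(Finset.mem_filter.1 hP).2]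
  have key := card_le_of_diagonal_tensor_eq (K := F) (B := B) (I := I)
    (fun i x => u i x)
    (fun i y z => ∑ P ∈ Q₀.filter fun P => e 0 P = i, C P * u (e 1 P) y * u (e 2 P) z)
    (fun i x z => ∑ P ∈ Q₁.filter fun P => e 1 P = i, C P * u (e 0 P) x * u (e 2 P) z)
    (fun i x y => ∑ P ∈ Q₂.filter fun P => e 2 P = i, C P * u (e 0 P) x * u (e 1 P) y)
    (fun x y z => by
      have hiff : (x = y ∧ y = z) ↔ (x : Fin m → F) + y = z + z := by
        constructor
        · rintro ⟨rfl, rfl⟩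
          rfl
        · intro h
          have hxy : x = y := Subtype.ext (hB x x.2 y y.2 z z.2 h)
          subst hxy
          refine ⟨rfl, Subtype.ext (funext fun t => ?_)⟩
          have := congrFun h t
          simp only [Pi.add_apply, ← two_mul] at this
          exact mul_left_cancel₀ h2 this
      rw [← hgroup Q₀ 0 (fun P hP => (Finset.mem_filter.1 hP).2),
        ← hgroup Q₁ 1 (fun P hP => (Finset.mem_filter.1 hP).2),
        ← hgroup Q₂ 2 (fun P hP => by
          simp only [Q₂, Finset.mem_filter] at hP
          exact hsome P hP.1.1 hP.1.2 hP.2)]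
      simp only [hiff]
      rw [hexp, ← Finset.sum_filter_add_sum_filter_not Q (fun P => e 0 P ∈ I),
        ← Finset.sum_filter_add_sum_filter_not (Q.filter fun P => e 0 P ∉ I)
          (fun P => e 1 P ∈ I), ← add_assoc]
      congr 1
      · congr 1 <;> exact Finset.sum_congr rfl fun P _ => by ring
      · exact Finset.sum_congr rfl fun P _ => by ring)
  simpa using key

theorem card_le_card_nontrivial_add {F : Type*} [Field F] [Fintype F] [DecidableEq F]
    (h2 : (2 : F) ≠ 0) {m : ℕ} (B : Finset (Fin m → F)) :
    (B.card : ℝ) ≤ ((Finset.univ.filter fun p : (Fin m → F) × (Fin m → F) =>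
        p.1 ≠ p.2 ∧ p.1 ∈ B ∧ p.2 ∈ B ∧ p.2 + p.2 - p.1 ∈ B).card : ℝ) +
      3 * (945 / 1000 * (Fintype.card F : ℝ)) ^ m := by
  set N := Finset.univ.filter fun p : (Fin m → F) × (Fin m → F) =>
        p.1 ≠ p.2 ∧ p.1 ∈ B ∧ p.2 ∈ B ∧ p.2 + p.2 - p.1 ∈ B
  have hk := Fintype.one_lt_card (α := F)
  have h1 := card_le_of_forall_add_eq_imp_eq h2 (B \ N.image Prod.fst) (by
    intro x hx y hy z hz h
    simp only [Finset.mem_sdiff] at hx hy hz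
    by_contra hxy
    refine hx.2 (Finset.mem_image.2 ⟨(x, z), ?_, rfl⟩)
    have hyz : z + z - x = y := by rw [← h]; simp
    simp only [N, Finset.mem_filter, Finset.mem_univ, true_and, hyz]
    refine ⟨?_, hx.1, hz.1, hy.1⟩
    rintro rfl
    exact hxy (add_left_cancel h).symm)
  have h3 := card_lowDegreeExponents_le (k := Fintype.card F - 1) (by omega) m
  rw [Nat.cast_sub hk.le, Nat.cast_one, sub_add_cancel] at h3
  have h4 : B.card ≤ N.card + (B \ N.image Prod.fst).card :=
    (Finset.card_le_card_sdiff_add_card (s := B) (t := N.image Prod.fst)).trans (by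
      have := Finset.card_image_le (s := N) (f := Prod.fst)
      omega)
  have h5 : (B.card : ℝ) ≤ N.card + 3 * (lowDegreeExponents (Fintype.card F - 1) m).card := by
    exact_mod_cast h4.trans (Nat.add_le_add_left h1 _)
  linarith

theorem AddMonoidHom.card_filter_mem_mul_card {G H : Type*} [AddGroup G] [AddGroup H] [Fintype G]
    [Fintype H] [DecidableEq H] (f : G →+ H) (hf : Function.Surjective f) (S : Finset H) :
    (Finset.univ.filter fun g => f g ∈ S).card * Fintype.card H = S.card * Fintype.card G := by
  have hfib : ∀ h, (Finset.univ.filter fun g => f g = h).card =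
      (Finset.univ.filter fun g => f g = 0).card := fun h =>
    AddMonoidHom.card_fiber_eq_of_mem_range f (hf h) (hf 0)
  have hcount : ∀ T : Finset H, (Finset.univ.filter fun g => f g ∈ T).card =
      T.card * (Finset.univ.filter fun g => f g = 0).card := by
    intro T
    rw [Finset.card_eq_sum_card_fiberwise (f := f) (t := T) (fun g hg => by simpa using hg),
      ← smul_eq_mul, ← Finset.sum_const]
    refine Finset.sum_congr rfl fun h hh => ?_
    rw [← hfib h, Finset.filter_filter]
    congr 1
    ext g
    simp only [Finset.mem_filter, Finset.mem_univ, true_and, and_iff_right_iff_imp]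
    rintro rfl
    exact hh
  have huniv := hcount Finset.univ
  simp only [Finset.mem_univ, Finset.filter_true, Finset.card_univ] at huniv
  rw [hcount, huniv]
  ring

section AffineMap

variable {F : Type*} [Field F] {m n : ℕ}

/-- Evaluation at `x` of the affine map `t ↦ a + M t`, as a function of the pair `(a, M)`. -/
def affineEval (x : Fin m → F) : (Fin n → F) × Matrix (Fin n) (Fin m) F →+ (Fin n → F) where
  toFun ω := ω.1 + ω.2.mulVec x
  map_zero' := by simp
  map_add' ω ω' := by
    simp only [Prod.fst_add, Prod.snd_add, Matrix.add_mulVec]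
    abel

theorem affineEval_surjective (x : Fin m → F) :
    Function.Surjective (affineEval (n := n) x) :=
  fun X => ⟨(X, 0), by simp [affineEval]⟩

theorem affineEval_prod_surjective {x z : Fin m → F} (h : x ≠ z) :
    Function.Surjective ((affineEval (n := n) x).prod (affineEval z)) := by
  rintro ⟨X, Z⟩
  obtain ⟨t, ht⟩ := Function.ne_iff.1 h
  let M : Matrix (Fin n) (Fin m) F := Matrix.vecMulVec (X - Z) (Pi.single t (x t - z t)⁻¹)
  have hM : M.mulVec x - M.mulVec z = X - Z := by
    rw [← Matrix.mulVec_sub, Matrix.vecMulVec_mulVec, single_dotProduct, Pi.sub_apply,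
      inv_mul_cancel₀ (sub_ne_zero.2 ht)]
    simp
  refine ⟨(X - M.mulVec x, M), Prod.ext ?_ ?_⟩
  · simp [affineEval]
  · simp only [AddMonoidHom.prod_apply, affineEval, AddMonoidHom.coe_mk, ZeroHom.coe_mk]
    rw [sub_add, hM, sub_sub_cancel]

theorem affineEval_add_sub (x z : Fin m → F) (ω : (Fin n → F) × Matrix (Fin n) (Fin m) F) :
    affineEval (z + z - x) ω = affineEval z ω + affineEval z ω - affineEval x ω := by
  simp only [affineEval, AddMonoidHom.coe_mk, ZeroHom.coe_mk, Matrix.mulVec_sub, Matrix.mulVec_add]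
  abel

end AffineMap

theorem density_mul_le_card_three_term_APs {F : Type*} [Field F] [Fintype F] [DecidableEq F]
    (h2 : (2 : F) ≠ 0) (m : ℕ) {n : ℕ} (A : Finset (Fin n → F)) :
    (Fintype.card F : ℝ) ^ m * (A.card / (Fintype.card F : ℝ) ^ n) ≤
      (Fintype.card F : ℝ) ^ (2 * m) *
        (((A ×ˢ A ×ˢ A).filter fun t => t.1 + t.2.1 = t.2.2 + t.2.2).card /
          (Fintype.card F : ℝ) ^ (2 * n)) + 3 * (945 / 1000 * (Fintype.card F : ℝ)) ^ m := by
  set q : ℝ := (Fintype.card F : ℝ) with hq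
  have hq0 : 0 < q := Nat.cast_pos.2 Fintype.card_pos
  set T := (A ×ˢ A ×ˢ A).filter fun t => t.1 + t.2.1 = t.2.2 + t.2.2
  let Ω := (Fin n → F) × Matrix (Fin n) (Fin m) F
  let w : ℝ := Fintype.card Ω
  have hw0 : 0 < w := Nat.cast_pos.2 Fintype.card_pos
  let S : Finset ((Fin n → F) × (Fin n → F)) := Finset.univ.filter fun p =>
    p.1 ∈ A ∧ p.2 ∈ A ∧ p.2 + p.2 - p.1 ∈ A
  have hST : (S.card : ℝ) ≤ T.card := by
    norm_cast
    refine Finset.card_le_card_of_injOn (fun p => (p.1, p.2 + p.2 - p.1, p.2)) ?_ ?_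
    · intro p hp
      simp only [S, Finset.coe_filter, Finset.mem_univ, true_and, Set.mem_ofPred_eq] at hp
      simp [T, hp]
    · intro p _ p' _ h
      simp only [Prod.mk.injEq] at h
      exact Prod.ext h.1 h.2.2
  let B : Ω → Finset (Fin m → F) := fun ω => Finset.univ.filter fun x => affineEval x ω ∈ A
  let N : Ω → Finset ((Fin m → F) × (Fin m → F)) := fun ω => Finset.univ.filter fun p =>
    p.1 ≠ p.2 ∧ p.1 ∈ B ω ∧ p.2 ∈ B ω ∧ p.2 + p.2 - p.1 ∈ B ω
  have hB : ∑ ω, ((B ω).card : ℝ) = q ^ m * (A.card / q ^ n) * w := by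
    have hx : ∀ x : Fin m → F,
        ((Finset.univ.filter fun ω : Ω => affineEval x ω ∈ A).card : ℝ) = A.card / q ^ n * w := by
      intro x
      have := (affineEval (n := n) x).card_filter_mem_mul_card (affineEval_surjective x) A
      rw [div_mul_eq_mul_div, eq_div_iff (by positivity)]
      rw [Fintype.card_fun, Fintype.card_fin] at this
      have := congrArg (Nat.cast (R := ℝ)) this
      rwa [Nat.cast_mul, Nat.cast_mul, Nat.cast_pow] at this
    have hswap : ∑ ω, (B ω).card =
        ∑ x, (Finset.univ.filter fun ω : Ω => affineEval x ω ∈ A).card :=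
      Finset.sum_card_bipartiteAbove_eq_sum_card_bipartiteBelow fun ω x => affineEval x ω ∈ A
    have hswap : ∑ ω, ((B ω).card : ℝ) =
        ∑ x, ((Finset.univ.filter fun ω : Ω => affineEval x ω ∈ A).card : ℝ) := by
      exact_mod_cast hswap
    simp [hswap, hx, hq, mul_assoc]
  have hN : ∑ ω, ((N ω).card : ℝ) ≤ q ^ (2 * m) * (T.card / q ^ (2 * n)) * w := by
    have hp : ∀ p : (Fin m → F) × (Fin m → F),
        ((Finset.univ.filter fun ω : Ω => p ∈ N ω).card : ℝ) ≤ T.card / q ^ (2 * n) * w := by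
      intro p
      by_cases hne : p.1 = p.2
      · simp only [N, hne, Finset.mem_filter]
        simp
        positivity
      · have := ((affineEval (n := n) p.1).prod (affineEval p.2)).card_filter_mem_mul_card
          (affineEval_prod_surjective hne) S
        have hcard : ((Finset.univ.filter fun ω : Ω => p ∈ N ω).card : ℝ) * q ^ (2 * n) =
            S.card * w := by
          rw [Fintype.card_prod, Fintype.card_fun, Fintype.card_fin, ← pow_add, ← two_mul] at this
          have := congrArg (Nat.cast (R := ℝ)) this
          rw [Nat.cast_mul, Nat.cast_mul, Nat.cast_pow] at this
          have hfilter : (Finset.univ.filter fun ω : Ω => p ∈ N ω) = Finset.univ.filter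
              fun ω => ((affineEval (n := n) p.1).prod (affineEval p.2)) ω ∈ S := by
            ext ω
            simp [N, B, S, hne, affineEval_add_sub]
          rwa [hfilter]
        rw [div_mul_eq_mul_div, le_div_iff₀ (by positivity), hcard]
        gcongr
    have hswap : ∑ ω, (N ω).card = ∑ p, (Finset.univ.filter fun ω : Ω => p ∈ N ω).card := by
      have := Finset.sum_card_bipartiteAbove_eq_sum_card_bipartiteBelow (s := Finset.univ)
        (t := Finset.univ) fun ω p => p ∈ N ω
      simpa [Finset.bipartiteAbove, Finset.bipartiteBelow] using this
    have hswap : ∑ ω, ((N ω).card : ℝ) =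
        ∑ p, ((Finset.univ.filter fun ω : Ω => p ∈ N ω).card : ℝ) := by
      exact_mod_cast hswap
    rw [hswap]
    refine (Finset.sum_le_card_nsmul _ _ _ fun p _ => hp p).trans (le_of_eq ?_)
    simp [hq]
    ring
  have hsum := Finset.sum_le_sum fun ω (_ : ω ∈ Finset.univ) =>
    card_le_card_nontrivial_add h2 (B ω)
  rw [Finset.sum_add_distrib, hB] at hsum
  refine le_of_mul_le_mul_right (hsum.trans ((add_le_add_left hN _).trans (le_of_eq ?_))) hw0
  simp [w]
  ring

theorem rpow_le_card_three_term_APs_of_two_ne_zero {F : Type*} [Field F] [Fintype F] [DecidableEq F]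
    (h2 : (2 : F) ≠ 0) {n : ℕ} {d : ℝ} (hd : 1 ≤ d) (A : Finset (Fin n → F))
    (hA : (2 : ℝ) ^ (-d) * (Fintype.card F : ℝ) ^ n ≤ A.card) :
    (Fintype.card F : ℝ) ^ (-(67 * d)) * (Fintype.card F : ℝ) ^ (2 * n) ≤
      (((A ×ˢ A ×ˢ A).filter fun t => t.1 + t.2.1 = t.2.2 + t.2.2).card : ℝ) := by
  have hmain := fun m => density_mul_le_card_three_term_APs h2 m A
  have hq2 : (2 : ℝ) ≤ Fintype.card F := by exact_mod_cast Fintype.one_lt_card (α := F)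
  set q : ℝ := (Fintype.card F : ℝ)
  have hq0 : 0 < q := by linarith
  set T : ℝ := (((A ×ˢ A ×ˢ A).filter fun t => t.1 + t.2.1 = t.2.2 + t.2.2).card : ℝ)
  rw [← le_div_iff₀ (by positivity)] at hA ⊢
  set k := ⌈d⌉₊ + 3 with hk
  have hk1 : d + 3 ≤ k := by
    have := Nat.le_ceil d
    push_cast [hk]
    linarith
  have hk2 : (k : ℝ) ≤ d + 4 := by
    have := (Nat.ceil_lt_add_one (by linarith : 0 ≤ d)).le
    push_cast [hk]
    linarith
  have hm := hmain (13 * k)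
  set m := 13 * k with hmdef
  have hκ : (945 / 1000 : ℝ) ^ m ≤ 2 ^ (-d) / 8 := by
    calc (945 / 1000 : ℝ) ^ m ≤ (1 / 2) ^ k := by
          rw [hmdef, pow_mul]
          exact pow_le_pow_left₀ (by positivity) (by norm_num) k
      _ = 2 ^ (-(k : ℝ)) := by
          rw [Real.rpow_neg (by norm_num), Real.rpow_natCast, one_div, inv_pow]
      _ ≤ 2 ^ (-d - 3) := Real.rpow_le_rpow_of_exponent_le (by norm_num) (by linarith)
      _ = 2 ^ (-d) / 8 := by
          rw [Real.rpow_sub (by norm_num)]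
          norm_num
  have hqm : 0 < q ^ m := by positivity
  have hα : (0 : ℝ) < 2 ^ (-d) := by positivity
  have hT : q ^ m * (2 ^ (-d) / 2) ≤ q ^ m * (q ^ m * (T / q ^ (2 * n))) := by
    have h1 := mul_le_mul_of_nonneg_left hA hqm.le
    have h3 := mul_le_mul_of_nonneg_left hκ hqm.le
    rw [mul_pow, two_mul m, pow_add] at hm
    have := mul_pos hqm hα
    nlinarith
  have hT := le_of_mul_le_mul_left hT hqm
  have hlow : q ^ (-d - 1) ≤ (2 : ℝ) ^ (-d) / 2 := by
    calc q ^ (-d - 1) ≤ (2 : ℝ) ^ (-d - 1) :=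
          Real.rpow_le_rpow_of_nonpos (by norm_num) hq2 (by linarith)
      _ = _ := by rw [Real.rpow_sub (by norm_num), Real.rpow_one]
  have hfin : q ^ m * q ^ (-(67 * d)) ≤ q ^ (-d - 1) := by
    rw [← Real.rpow_natCast, ← Real.rpow_add hq0]
    refine Real.rpow_le_rpow_of_exponent_le (by linarith) ?_
    push_cast [hmdef]
    linarith
  exact le_of_mul_le_mul_left (hfin.trans (hlow.trans hT)) hqm

theorem rpow_le_card_three_term_APs_of_two_eq_zero {F : Type*} [Field F] [Fintype F] [DecidableEq F]
    (h2 : (2 : F) = 0) {n : ℕ} {d : ℝ} (hd : 1 ≤ d) (A : Finset (Fin n → F))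
    (hA : (2 : ℝ) ^ (-d) * (Fintype.card F : ℝ) ^ n ≤ A.card) :
    (Fintype.card F : ℝ) ^ (-(2 * d)) * (Fintype.card F : ℝ) ^ (2 * n) ≤
      (((A ×ˢ A ×ˢ A).filter fun t => t.1 + t.2.1 = t.2.2 + t.2.2).card : ℝ) := by
  have hq2 : (2 : ℝ) ≤ Fintype.card F := by exact_mod_cast Fintype.one_lt_card (α := F)
  have hself : ∀ x : Fin n → F, x + x = 0 := fun x => by
    ext t
    simp [← two_mul, h2]
  have hcard : (A ×ˢ A).card ≤
      ((A ×ˢ A ×ˢ A).filter fun t => t.1 + t.2.1 = t.2.2 + t.2.2).card := by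
    refine Finset.card_le_card_of_injOn (fun p => (p.1, p.1, p.2)) ?_ ?_
    · intro p hp
      have hp := Finset.mem_product.1 hp
      simp [hself, hp]
    · intro p _ p' _ h
      simp only [Prod.mk.injEq] at h
      exact Prod.ext h.1 h.2.2
  rw [Finset.card_product, ← sq] at hcard
  calc (Fintype.card F : ℝ) ^ (-(2 * d)) * (Fintype.card F : ℝ) ^ (2 * n)
      ≤ (2 : ℝ) ^ (-(2 * d)) * (Fintype.card F : ℝ) ^ (2 * n) := by
        gcongr ?_ * _
        exact Real.rpow_le_rpow_of_nonpos (by norm_num) hq2 (by linarith)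
    _ = ((2 : ℝ) ^ (-d) * (Fintype.card F : ℝ) ^ n) ^ 2 := by
        rw [mul_pow, ← pow_mul, mul_comm n 2, ← Real.rpow_mul_natCast (by norm_num)]
        congr 2
        push_cast
        ring
    _ ≤ (A.card : ℝ) ^ 2 := by gcongr
    _ ≤ _ := by exact_mod_cast hcard

/-- There is an absolute constant `C ≥ 1` such that for every finite field `F` with `q`
elements, `n ≥ 1` and `A ⊆ 𝔽_q^n` with `|A| ≥ 2^{-d}·q^n` (`d ≥ 1`), the number of triples
`(x,y,z) ∈ A³` with `x + y = 2·z` is at least `q^{-C·d^9} · q^{2n}`. -/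
theorem many_three_term_APs_finite_field :
    ∃ C : ℝ, 1 ≤ C ∧ ∀ (F : Type) [Field F] [Fintype F] [DecidableEq F] (n : ℕ), 1 ≤ n →
      ∀ d : ℝ, 1 ≤ d → ∀ A : Finset (Fin n → F),
      (2:ℝ) ^ (-d) * (Fintype.card F : ℝ) ^ n ≤ A.card →
      (Fintype.card F : ℝ) ^ (-(C * d ^ 9)) * (Fintype.card F : ℝ) ^ (2 * n) ≤
        (((A ×ˢ A ×ˢ A).filter fun t => t.1 + t.2.1 = t.2.2 + t.2.2).card : ℝ) := by
  refine ⟨67, by norm_num, fun F _ _ _ n _ d hd A hA => ?_⟩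
  have hq1 : (1 : ℝ) ≤ Fintype.card F := by exact_mod_cast Fintype.card_pos
  have hd9 : d ≤ d ^ 9 := le_self_pow₀ hd (by norm_num)
  by_cases h2 : (2 : F) = 0
  · refine le_trans ?_ (rpow_le_card_three_term_APs_of_two_eq_zero h2 hd A hA)
    gcongr ?_ * _
    exact Real.rpow_le_rpow_of_exponent_le hq1 (by linarith)
  · refine le_trans ?_ (rpow_le_card_three_term_APs_of_two_ne_zero h2 hd A hA)
    gcongr ?_ * _
    exact Real.rpow_le_rpow_of_exponent_le hq1 (by linarith)
end

section
/- There is an absolute constant C ≥ 1 such that the following holds. Let F be a finite field with q elements, n ≥ 1, fix τ ∈ (0, 1/2], and suppose A ⊆ 𝔽_q^n has |A| ≥ 2^{−d}·q^n for some real d ≥ 1. Then there is a nonempty subset A′ ⊆ A such that: (i) |A′| · q^n ≥ |A| · |Span*(A′)|; (ii) the codimension of Span*(A′) is at most C · d^5 · (log(1/τ))^4; and (iii) |A′ + A′| ≥ (1 − τ) · |Span*(A′)|. -/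
open Pointwise

section Auxiliary

open Finset

/-- The sum of the diagonal translates of a tensor power of `f`. -/
noncomputable def diagSum {G : Type*} [AddCommGroup G] [Fintype G] (f : G → ℝ) (p : ℕ)
    (y : Fin p → G) : ℝ := ∑ x, ∏ i, f (y i + x)

lemma sum_conv_pow_eq {G : Type*} [AddCommGroup G] [Fintype G] (f : G → ℝ) (p : ℕ) :
    (Fintype.card G : ℝ) * ∑ x, (∑ y, f y * f (x - y)) ^ p =
      ∑ y : Fin p → G, diagSum f p y * diagSum f p (-y) := by
  have h : ∀ x : G, ∑ y : Fin p → G, (∏ i, f (y i + x)) * diagSum f p (-y) =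
      ∑ x, (∑ y, f y * f (x - y)) ^ p := by
    intro x
    rw [← Equiv.sum_comp (Equiv.subRight (fun _ : Fin p => x))]
    simp only [diagSum, Equiv.subRight_apply, Pi.sub_apply, Pi.neg_apply, sub_add_cancel,
      Finset.mul_sum, Fintype.sum_pow, ← Finset.prod_mul_distrib]
    rw [Finset.sum_comm, ← Equiv.sum_comp (Equiv.subRight x)]
    refine Finset.sum_congr rfl fun z _ => Finset.sum_congr rfl fun y _ =>
      Finset.prod_congr rfl fun i _ => ?_
    simp only [Equiv.subRight_apply]
    congr 2
    abel
  conv_rhs => simp only [diagSum, Finset.sum_mul]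
  rw [Finset.sum_comm]
  conv_rhs => enter [2, x]; rw [show (fun y : Fin p → G => (∏ i, f (y i + x)) *
    ∑ x, ∏ i, f ((-y) i + x)) = fun y => (∏ i, f (y i + x)) * diagSum f p (-y) from rfl, h x]
  simp

lemma sum_corr_pow_eq {G : Type*} [AddCommGroup G] [Fintype G] (f : G → ℝ) (p : ℕ) :
    (Fintype.card G : ℝ) * ∑ x, (∑ y, f y * f (y + x)) ^ p =
      ∑ y : Fin p → G, diagSum f p y ^ 2 := by
  have h : ∀ x : G, ∑ y : Fin p → G, (∏ i, f (y i + x)) * diagSum f p y =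
      ∑ x, (∑ y, f y * f (y + x)) ^ p := by
    intro x
    rw [← Equiv.sum_comp (Equiv.subRight (fun _ : Fin p => x))]
    simp only [diagSum, Equiv.subRight_apply, Pi.sub_apply, sub_add_cancel,
      Finset.mul_sum, Fintype.sum_pow, ← Finset.prod_mul_distrib]
    rw [Finset.sum_comm, ← Equiv.sum_comp (Equiv.addRight x)]
    refine Finset.sum_congr rfl fun z _ => Finset.sum_congr rfl fun y _ =>
      Finset.prod_congr rfl fun i _ => ?_
    simp only [Equiv.coe_addRight]
    congr 2
    abel
  conv_rhs => simp only [sq]; simp only [diagSum, Finset.sum_mul]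
  rw [Finset.sum_comm]
  conv_rhs => enter [2, x]; rw [show (fun y : Fin p → G => (∏ i, f (y i + x)) *
    ∑ x, ∏ i, f (y i + x)) = fun y => (∏ i, f (y i + x)) * diagSum f p y from rfl, h x]
  simp

lemma sum_corr_pow_nonneg {G : Type*} [AddCommGroup G] [Fintype G] (f : G → ℝ) (p : ℕ) :
    0 ≤ ∑ x, (∑ y, f y * f (y + x)) ^ p := by
  have h := sum_corr_pow_eq f p
  have hN : (0 : ℝ) < Fintype.card G := by exact_mod_cast Fintype.card_pos
  exact nonneg_of_mul_nonneg_right (h ▸ Finset.sum_nonneg fun _ _ => sq_nonneg _) hN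

lemma sum_conv_pow_le_sum_corr_pow {G : Type*} [AddCommGroup G] [Fintype G] (f : G → ℝ) (p : ℕ) :
    ∑ x, (∑ y, f y * f (x - y)) ^ p ≤ ∑ x, (∑ y, f y * f (y + x)) ^ p := by
  have hN : (0 : ℝ) < Fintype.card G := by exact_mod_cast Fintype.card_pos
  refine le_of_mul_le_mul_left ?_ hN
  rw [sum_conv_pow_eq, sum_corr_pow_eq]
  have h1 : ∑ y : Fin p → G, diagSum f p (-y) ^ 2 = ∑ y : Fin p → G, diagSum f p y ^ 2 :=
    Equiv.sum_comp (Equiv.neg _) (fun y => diagSum f p y ^ 2)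
  have h2 : ∑ y : Fin p → G, diagSum f p y * diagSum f p (-y) ≤
      ∑ y : Fin p → G, (diagSum f p y ^ 2 + diagSum f p (-y) ^ 2) / 2 :=
    Finset.sum_le_sum fun y _ => by nlinarith [sq_nonneg (diagSum f p y - diagSum f p (-y))]
  rw [← Finset.sum_div, Finset.sum_add_distrib, h1] at h2
  linarith

lemma choose_mul_sum_pow_le {G : Type*} [Fintype G] (g : G → ℝ) (hg : ∀ k, 0 ≤ ∑ x, g x ^ k)
    {p M : ℕ} (h : p ≤ M) : (M.choose p : ℝ) * ∑ x, g x ^ p ≤ ∑ x, (g x + 1) ^ M := by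
  simp only [add_pow, one_pow, mul_one]
  rw [Finset.sum_comm]
  simp only [← Finset.sum_mul]
  rw [mul_comm]
  exact Finset.single_le_sum (f := fun k => (∑ x, g x ^ k) * (M.choose k : ℝ))
    (fun k _ => mul_nonneg (hg k) (by positivity)) (by simpa using Nat.lt_succ_of_le h)

lemma four_pow_le_choose (p : ℕ) : 4 ^ p ≤ (4 * p).choose p := by
  induction p with
  | zero => simp
  | succ p ih =>
    have h1 := Nat.add_one_mul_choose_eq (4 * p + 3) p
    have h2 : (4 * p).choose p ≤ (4 * p + 3).choose p := Nat.choose_mono p (by omega)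
    have h3 : (4 * (p + 1)).choose (p + 1) = 4 * (4 * p + 3).choose p := by
      refine Nat.eq_of_mul_eq_mul_right (Nat.succ_pos p) ?_
      rw [show 4 * (p + 1) = 4 * p + 3 + 1 by ring, Nat.succ_eq_add_one, ← h1]
      ring
    rw [h3, pow_succ]
    omega

/-- The real-valued indicator function of a set. -/
noncomputable def ind {G : Type*} (A : Set G) : G → ℝ := A.indicator 1

lemma ind_of_mem {G : Type*} {A : Set G} {x : G} (h : x ∈ A) : ind A x = 1 := by
  simp [ind, h]

lemma ind_of_notMem {G : Type*} {A : Set G} {x : G} (h : x ∉ A) : ind A x = 0 := by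
  simp [ind, h]

lemma ind_nonneg {G : Type*} (A : Set G) (x : G) : 0 ≤ ind A x := by
  by_cases h : x ∈ A <;> simp [ind, h]

lemma ind_le_one {G : Type*} (A : Set G) (x : G) : ind A x ≤ 1 := by
  by_cases h : x ∈ A <;> simp [ind, h]

lemma sum_ind {G : Type*} [Fintype G] (A : Finset G) : ∑ x, ind (A : Set G) x = #A := by
  classical
  simp [ind, Set.indicator_apply]

lemma sum_ind_mul {G : Type*} [Fintype G] (A : Finset G) (f : G → ℝ) :
    ∑ x, ind (A : Set G) x * f x = ∑ x ∈ A, f x := by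
  classical
  simp [ind, Set.indicator_apply]

/-- The number of representations of `x` as a difference of two elements of `A`. -/
noncomputable def diffCount {G : Type*} [AddCommGroup G] [Fintype G] (A : Finset G) (x : G) : ℝ :=
  ∑ y, ind (A : Set G) y * ind (A : Set G) (y + x)

lemma diffCount_nonneg {G : Type*} [AddCommGroup G] [Fintype G] (A : Finset G) (x : G) :
    0 ≤ diffCount A x :=
  Finset.sum_nonneg fun _ _ => mul_nonneg (ind_nonneg _ _) (ind_nonneg _ _)

lemma sum_balanced_mul_balanced {G : Type*} [Fintype G] (i j : G → ℝ) {a : ℝ} (ha : a ≠ 0)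
    (hi : ∑ y, i y = a) (hj : ∑ y, j y = a) :
    ∑ y, (Fintype.card G / a * i y - 1) * (Fintype.card G / a * j y - 1) =
      (Fintype.card G / a) ^ 2 * ∑ y, i y * j y - Fintype.card G := by
  have : ∀ y, ((Fintype.card G : ℝ) / a * i y - 1) * (Fintype.card G / a * j y - 1) =
      (Fintype.card G / a) ^ 2 * (i y * j y) - Fintype.card G / a * i y
        - Fintype.card G / a * j y + 1 := fun y => by ring
  simp only [this, Finset.sum_add_distrib, Finset.sum_sub_distrib, ← Finset.mul_sum, hi, hj]
  simp
  field_simp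
  ring

/-- If `A + A` misses a proportion `τ` of the group, then high moments of the difference
representation function are larger than expected. -/
lemma moment_diffCount_ge {G : Type*} [AddCommGroup G] [Fintype G] [DecidableEq G] (A : Finset G)
    (hA : A.Nonempty) {τ : ℝ} (h : ((A + A).card : ℝ) ≤ (1 - τ) * Fintype.card G) {p : ℕ}
    (hp : Even p) (hpτ : (1 / 2 : ℝ) ^ p ≤ τ) :
    2 ^ p * Fintype.card G * ((#A : ℝ) ^ 2 / Fintype.card G) ^ (4 * p) ≤
      ∑ x, diffCount A x ^ (4 * p) := by
  set N : ℝ := (Fintype.card G : ℝ) with hNdef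
  have hN : 0 < N := by rw [hNdef]; exact_mod_cast Fintype.card_pos
  have ha : (0 : ℝ) < #A := by exact_mod_cast hA.card_pos
  set a : ℝ := (#A : ℝ) with hadef
  set f : G → ℝ := fun y => N / a * ind (A : Set G) y - 1 with hf
  have hsum : ∑ y, ind (A : Set G) y = a := sum_ind A
  have hconv : ∀ x, ∑ y, f y * f (x - y) =
      (N / a) ^ 2 * ∑ y, ind (A : Set G) y * ind (A : Set G) (x - y) - N := fun x =>
    sum_balanced_mul_balanced _ (fun y => ind (A : Set G) (x - y)) ha.ne' hsum
      ((Equiv.sum_comp (Equiv.subLeft x) (ind (A : Set G))).trans hsum)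
  have hcorr : ∀ x, ∑ y, f y * f (y + x) = (N / a) ^ 2 * diffCount A x - N := fun x =>
    sum_balanced_mul_balanced _ (fun y => ind (A : Set G) (y + x)) ha.ne' hsum
      ((Equiv.sum_comp (Equiv.addRight x) (ind (A : Set G))).trans hsum)
  have h1 : τ * N * N ^ p ≤ ∑ x, (∑ y, f y * f (x - y)) ^ p := by
    have hc : τ * N ≤ ((A + A)ᶜ.card : ℝ) := by
      have : (((A + A).card : ℝ) + ((A + A)ᶜ.card : ℝ)) = N := by
        rw [hNdef]; exact_mod_cast Finset.card_add_card_compl (A + A)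
      linarith
    calc τ * N * N ^ p ≤ ((A + A)ᶜ.card : ℝ) * N ^ p := by gcongr
      _ = ∑ x ∈ (A + A)ᶜ, (∑ y, f y * f (x - y)) ^ p := by
        rw [Finset.sum_congr rfl (g := fun _ => N ^ p)]
        · simp
        · intro x hx
          rw [hconv, Finset.sum_eq_zero, mul_zero, zero_sub, hp.neg_pow]
          intro y _
          by_cases hy : y ∈ A
          · rw [ind_of_notMem (x := x - y), mul_zero]
            intro hxy
            exact Finset.mem_compl.1 hx (Finset.mem_add.2 ⟨y, hy, x - y, hxy, by abel⟩)
          · rw [ind_of_notMem (by simpa using hy), zero_mul]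
      _ ≤ _ := Finset.sum_le_sum_of_subset_of_nonneg (Finset.subset_univ _)
        fun x _ _ => hp.pow_nonneg _
  have h2 := h1.trans (sum_conv_pow_le_sum_corr_pow f p)
  set g : G → ℝ := fun x => (∑ y, f y * f (y + x)) / N with hg
  have hgk : ∀ k, 0 ≤ ∑ x, g x ^ k := fun k => by
    simp only [hg, div_pow, ← Finset.sum_div]
    exact div_nonneg (sum_corr_pow_nonneg f k) (by positivity)
  have hgp : τ * N ≤ ∑ x, g x ^ p := by
    simp only [hg, div_pow, ← Finset.sum_div]
    rwa [le_div_iff₀ (by positivity)]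
  have h3 := choose_mul_sum_pow_le g hgk (show p ≤ 4 * p by omega)
  have h4 : (4 : ℝ) ^ p ≤ ((4 * p).choose p : ℝ) := by exact_mod_cast four_pow_le_choose p
  have h5 : ∀ x, g x + 1 = N / a ^ 2 * diffCount A x := fun x => by
    simp only [hg, hcorr]; field_simp; ring
  simp only [h5, mul_pow, ← Finset.mul_sum] at h3
  have h6 : (2 : ℝ) ^ p * N ≤ (N / a ^ 2) ^ (4 * p) * ∑ x, diffCount A x ^ (4 * p) := by
    refine le_trans ?_ h3
    calc (2 : ℝ) ^ p * N = 4 ^ p * ((1 / 2) ^ p * N) := by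
          rw [← mul_assoc, ← mul_pow]; norm_num
      _ ≤ _ := by gcongr; exact le_trans (by gcongr) hgp
  have h7 : (a ^ 2 / N) ^ (4 * p) * (N / a ^ 2) ^ (4 * p) = 1 := by
    rw [← mul_pow, div_mul_div_cancel₀ hN.ne', div_self (by positivity), one_pow]
  calc 2 ^ p * N * (a ^ 2 / N) ^ (4 * p) ≤
      ((N / a ^ 2) ^ (4 * p) * ∑ x, diffCount A x ^ (4 * p)) * (a ^ 2 / N) ^ (4 * p) := by gcongr
    _ = ((a ^ 2 / N) ^ (4 * p) * (N / a ^ 2) ^ (4 * p)) * ∑ x, diffCount A x ^ (4 * p) := by ring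
    _ = _ := by rw [h7, one_mul]

lemma ind_eq_prod {G : Type*} [AddCommGroup G] {q : ℕ} (A : Set G) (s : Fin q → G) (y : G) :
    ind {z | ∀ i, z - s i ∈ A} y = ∏ i, ind A (y - s i) := by
  by_cases h : ∀ i, y - s i ∈ A
  · rw [ind_of_mem (A := {z | ∀ i, z - s i ∈ A}) h, Finset.prod_eq_one fun i _ => ind_of_mem (h i)]
  · rw [ind_of_notMem (A := {z | ∀ i, z - s i ∈ A}) h]
    obtain ⟨i, hi⟩ := not_forall.1 h
    exact (Finset.prod_eq_zero (Finset.mem_univ i) (ind_of_notMem hi)).symm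

/-- The intersection of the translates `A + s i`. -/
noncomputable def interTranslates {G : Type*} [AddCommGroup G] [Fintype G] {q : ℕ} (A : Finset G)
    (s : Fin q → G) : Finset G :=
  Set.Finite.toFinset (s := {z | ∀ i, z - s i ∈ (A : Set G)}) (Set.toFinite _)

lemma coe_interTranslates {G : Type*} [AddCommGroup G] [Fintype G] {q : ℕ} (A : Finset G)
    (s : Fin q → G) : (interTranslates A s : Set G) = {z | ∀ i, z - s i ∈ (A : Set G)} := by
  simp [interTranslates]

lemma sum_card_interTranslates {G : Type*} [AddCommGroup G] [Fintype G] (A : Finset G) (q : ℕ) :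
    ∑ s : Fin q → G, (#(interTranslates A s) : ℝ) = Fintype.card G * (#A : ℝ) ^ q := by
  simp_rw [← sum_ind, coe_interTranslates, ind_eq_prod]
  rw [Finset.sum_comm]
  have : ∀ y : G, ∑ s : Fin q → G, ∏ i, ind (A : Set G) (y - s i) = (#A : ℝ) ^ q := fun y => by
    rw [← Fintype.sum_pow (fun s => ind (A : Set G) (y - s))]
    congr 1
    exact (Equiv.sum_comp (Equiv.subLeft y) (ind (A : Set G))).trans (sum_ind A)
  simp only [this]
  simp [sum_ind]

lemma sum_mul_diffCount_interTranslates {G : Type*} [AddCommGroup G] [Fintype G] (A : Finset G)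
    (q : ℕ) (w : G → ℝ) :
    ∑ s : Fin q → G, ∑ x, w x * diffCount (interTranslates A s) x =
      Fintype.card G * ∑ x, w x * diffCount A x ^ q := by
  rw [Finset.sum_comm, Finset.mul_sum]
  refine Finset.sum_congr rfl fun x _ => ?_
  rw [← Finset.mul_sum, mul_left_comm]
  congr 1
  simp_rw [diffCount, coe_interTranslates, ind_eq_prod]
  rw [Finset.sum_comm]
  simp_rw [← Finset.prod_mul_distrib]
  have : ∀ y : G, ∑ s : Fin q → G, ∏ i, ind (A : Set G) (y - s i) * ind (A : Set G) (y + x - s i) =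
      diffCount A x ^ q := fun y => by
    rw [← Fintype.sum_pow (fun s => ind (A : Set G) (y - s) * ind (A : Set G) (y + x - s))]
    congr 1
    rw [diffCount, ← Equiv.sum_comp (Equiv.subLeft y)]
    refine Finset.sum_congr rfl fun s _ => ?_
    simp only [Equiv.subLeft_apply]
    congr 2 <;> abel
  simp only [this]
  simp [diffCount]

lemma sum_diffCount {G : Type*} [AddCommGroup G] [Fintype G] (B : Finset G) :
    ∑ x, diffCount B x = (#B : ℝ) ^ 2 := by
  simp only [diffCount]
  rw [Finset.sum_comm]
  simp only [← Finset.mul_sum]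
  have : ∀ y : G, ∑ x, ind (B : Set G) (y + x) = #B := fun y =>
    (Equiv.sum_comp (Equiv.addLeft y) (ind (B : Set G))).trans (sum_ind B)
  simp only [this, ← Finset.sum_mul, sum_ind, sq]

/-- Sifting: if the `q`-th moment of `diffCount A` is concentrated on `S`, then some large
intersection of translates of `A` has almost all its differences in `S`. -/
lemma exists_sifted_set {G : Type*} [AddCommGroup G] [Fintype G] (A : Finset G) (q : ℕ) (S : Set G)
    {ε η : ℝ} (hε : 0 < ε) (hε3 : 3 * ε ≤ 1) (hη : 0 < η) (hM : 0 < ∑ x, diffCount A x ^ q)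
    (h1 : ∑ x, ind Sᶜ x * diffCount A x ^ q ≤ ε * ∑ x, diffCount A x ^ q)
    (h2 : η * Fintype.card G * (#A : ℝ) ^ q ≤ ε * ∑ x, diffCount A x ^ q) :
    ∃ B : Finset G, η * Fintype.card G ≤ #B ∧
      ∑ x, ind Sᶜ x * diffCount B x ≤ 3 * ε * (#B : ℝ) ^ 2 := by
  by_contra! hcon
  set N : ℝ := (Fintype.card G : ℝ) with hNdef
  have hN : 0 < N := by rw [hNdef]; exact_mod_cast Fintype.card_pos
  have key : ∀ s : Fin q → G, 3 * ε * (#(interTranslates A s) : ℝ) ^ 2 ≤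
      ∑ x, ind Sᶜ x * diffCount (interTranslates A s) x +
        η * N * #(interTranslates A s) := by
    intro s
    set b : ℝ := (#(interTranslates A s) : ℝ) with hb
    have hb0 : 0 ≤ b := by positivity
    rcases le_or_gt (η * N) b with h | h
    · have := hcon _ h
      have : 0 ≤ η * N * b := by positivity
      linarith
    · have h3 : 0 ≤ ∑ x, ind Sᶜ x * diffCount (interTranslates A s) x :=
        Finset.sum_nonneg fun x _ => mul_nonneg (ind_nonneg _ _) (diffCount_nonneg _ _)
      nlinarith [mul_le_mul_of_nonneg_right h.le hb0, mul_le_mul_of_nonneg_right hε3 (sq_nonneg b)]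
  have hs := Finset.sum_le_sum fun s (_ : s ∈ Finset.univ) => key s
  rw [Finset.sum_add_distrib, ← Finset.mul_sum, ← Finset.mul_sum, sum_card_interTranslates,
    sum_mul_diffCount_interTranslates] at hs
  have h4 := sum_mul_diffCount_interTranslates A q (fun _ => 1)
  simp only [one_mul, sum_diffCount] at h4
  rw [h4] at hs
  have h5 := mul_le_mul_of_nonneg_left h1 hN.le
  have h6 := mul_le_mul_of_nonneg_left h2 hN.le
  have h7 : 0 < N * (ε * ∑ x, diffCount A x ^ q) := by positivity
  nlinarith

/-- If `A + A` misses a proportion `τ` of the group, then there is a fairly large set almost all of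
whose differences are popular differences of `A`. -/
lemma exists_set_popular_differences {G : Type*} [AddCommGroup G] [Fintype G] [DecidableEq G]
    (A : Finset G) (hA : A.Nonempty) {τ : ℝ} (h : ((A + A).card : ℝ) ≤ (1 - τ) * Fintype.card G)
    {p : ℕ} (hp : Even p) (hp20 : 20 ≤ p) (hpτ : (1 / 2 : ℝ) ^ p ≤ τ) :
    ∃ B : Finset G, 1 / 300 * ((#A : ℝ) / Fintype.card G) ^ (4 * p) * Fintype.card G ≤ #B ∧
      ∑ x, ind {x | 11 / 10 * ((#A : ℝ) ^ 2 / Fintype.card G) < diffCount A x}ᶜ x * diffCount B x ≤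
        1 / 100 * (#B : ℝ) ^ 2 := by
  have hm := moment_diffCount_ge A hA h hp hpτ
  set N : ℝ := (Fintype.card G : ℝ) with hNdef
  have hN : 0 < N := by rw [hNdef]; exact_mod_cast Fintype.card_pos
  have ha : (0 : ℝ) < #A := by exact_mod_cast hA.card_pos
  set a : ℝ := (#A : ℝ) with hadef
  have hM : 0 < 2 ^ p * N * (a ^ 2 / N) ^ (4 * p) := by positivity
  have hnum : ((11 / 10 : ℝ)) ^ (4 * p) ≤ 1 / 300 * 2 ^ p := by
    obtain ⟨r, rfl⟩ := Nat.exists_eq_add_of_le hp20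
    rw [pow_mul, pow_add, pow_add, ← mul_assoc]
    gcongr <;> norm_num
  suffices h12 : ∑ x, ind {x | 11 / 10 * (a ^ 2 / N) < diffCount A x}ᶜ x * diffCount A x ^ (4 * p) ≤
      1 / 300 * ∑ x, diffCount A x ^ (4 * p) ∧ 1 / 300 * (a / N) ^ (4 * p) * N * a ^ (4 * p) ≤
      1 / 300 * ∑ x, diffCount A x ^ (4 * p) by
    obtain ⟨B, hB1, hB2⟩ := exists_sifted_set A (4 * p) _ (by norm_num) (by norm_num)
      (by positivity) (hM.trans_le hm) h12.1 h12.2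
    exact ⟨B, hB1, hB2.trans (by norm_num)⟩
  constructor
  · calc _ ≤ ∑ _x : G, (11 / 10 * (a ^ 2 / N)) ^ (4 * p) := by
          refine Finset.sum_le_sum fun x _ => ?_
          by_cases hx : 11 / 10 * (a ^ 2 / N) < diffCount A x
          · rw [ind_of_notMem (by simpa using hx), zero_mul]; positivity
          · rw [ind_of_mem (by simpa using hx), one_mul]
            exact pow_le_pow_left₀ (diffCount_nonneg _ _) (not_lt.1 hx) _
      _ = (11 / 10) ^ (4 * p) * (N * (a ^ 2 / N) ^ (4 * p)) := by
          simp [mul_pow]; ring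
      _ ≤ 1 / 300 * 2 ^ p * (N * (a ^ 2 / N) ^ (4 * p)) := by gcongr
      _ = 1 / 300 * (2 ^ p * N * (a ^ 2 / N) ^ (4 * p)) := by ring
      _ ≤ _ := by gcongr
  · refine le_trans ?_ (mul_le_mul_of_nonneg_left hm (by norm_num))
    have : (a ^ 2 / N) ^ (4 * p) = (a / N) ^ (4 * p) * a ^ (4 * p) := by
      rw [← mul_pow]; congr 1; ring
    rw [this]
    have h2 : (1 : ℝ) ≤ 2 ^ p := one_le_pow₀ (by norm_num)
    have h3 : 0 ≤ 1 / 300 * (N * ((a / N) ^ (4 * p) * a ^ (4 * p))) := by positivity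
    nlinarith [mul_le_mul_of_nonneg_right h2 h3]

lemma exp_mul_le_cosh_add {l x : ℝ} (hx : |x| ≤ 1) :
    Real.exp (l * x) ≤ Real.cosh l + x * Real.sinh l := by
  obtain ⟨h1, h2⟩ := abs_le.1 hx
  have h := convexOn_exp.2 (Set.mem_univ l) (Set.mem_univ (-l))
    (show 0 ≤ (1 + x) / 2 by linarith) (show 0 ≤ (1 - x) / 2 by linarith) (by ring)
  simp only [smul_eq_mul] at h
  rw [Real.cosh_eq, Real.sinh_eq]
  calc Real.exp (l * x) = Real.exp ((1 + x) / 2 * l + (1 - x) / 2 * -l) := by congr 1; ring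
    _ ≤ _ := h
    _ = _ := by ring

lemma sum_exp_le_of_sum_eq_zero {ι : Type*} (B : Finset ι) (X : ι → ℝ) (hX : ∀ b, |X b| ≤ 1)
    (h0 : ∑ b ∈ B, X b = 0) (l : ℝ) :
    ∑ b ∈ B, Real.exp (l * X b) ≤ #B * Real.exp (l ^ 2 / 2) :=
  calc ∑ b ∈ B, Real.exp (l * X b) ≤ ∑ b ∈ B, (Real.cosh l + X b * Real.sinh l) :=
        Finset.sum_le_sum fun b _ => exp_mul_le_cosh_add (hX b)
    _ = #B * Real.cosh l := by
        rw [Finset.sum_add_distrib, ← Finset.sum_mul, h0]; simp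
    _ ≤ _ := by gcongr; exact Real.cosh_le_exp_half_sq l

lemma sum_piFinset_exp_le {ι : Type*} (B : Finset ι) (X : ι → ℝ) (hX : ∀ b, |X b| ≤ 1)
    (h0 : ∑ b ∈ B, X b = 0) (m : ℕ) (l : ℝ) :
    ∑ a ∈ Fintype.piFinset (fun _ : Fin m => B), Real.exp (l * ∑ i, X (a i)) ≤
      (#B : ℝ) ^ m * Real.exp (m * (l ^ 2 / 2)) := by
  simp_rw [Finset.mul_sum, Real.exp_sum]
  rw [← Finset.prod_univ_sum (fun _ : Fin m => B) (fun _ b => Real.exp (l * X b))]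
  rw [Finset.prod_const, Finset.card_univ, Fintype.card_fin, Real.exp_nat_mul, ← mul_pow]
  exact pow_le_pow_left₀ (Finset.sum_nonneg fun _ _ => (Real.exp_pos _).le)
    (sum_exp_le_of_sum_eq_zero B X hX h0 l) m

/-- Hoeffding's inequality for uniform samples from a finite set. -/
lemma card_large_sample_sum_le {ι : Type*} (B : Finset ι) (X : ι → ℝ) (hX : ∀ b, |X b| ≤ 1)
    (h0 : ∑ b ∈ B, X b = 0) (m : ℕ) {ε : ℝ} (hε : 0 ≤ ε) :
    ∑ a ∈ Fintype.piFinset (fun _ : Fin m => B), ind {a : Fin m → ι | m * ε < |∑ i, X (a i)|} a ≤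
      2 * Real.exp (-(m * ε ^ 2 / 2)) * (#B : ℝ) ^ m := by
  have h1 := sum_piFinset_exp_le B X hX h0 m ε
  have h2 := sum_piFinset_exp_le B X hX h0 m (-ε)
  have key : ∀ a : Fin m → ι, ind {a : Fin m → ι | m * ε < |∑ i, X (a i)|} a ≤
      Real.exp (-(m * ε ^ 2)) * (Real.exp (ε * ∑ i, X (a i)) + Real.exp (-ε * ∑ i, X (a i))) := by
    intro a
    by_cases h : m * ε < |∑ i, X (a i)|
    · rw [ind_of_mem (by simpa using h), mul_add, ← Real.exp_add, ← Real.exp_add]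
      have h3 := mul_le_mul_of_nonneg_left h.le hε
      rcases abs_cases (∑ i, X (a i)) with ⟨h4, -⟩ | ⟨h4, -⟩ <;> rw [h4] at h3
      · have := Real.one_le_exp (x := -(m * ε ^ 2) + ε * ∑ i, X (a i)) (by linarith)
        have := Real.exp_pos (-(m * ε ^ 2) + -ε * ∑ i, X (a i))
        linarith
      · have := Real.one_le_exp (x := -(m * ε ^ 2) + -ε * ∑ i, X (a i)) (by linarith)
        have := Real.exp_pos (-(m * ε ^ 2) + ε * ∑ i, X (a i))
        linarith
    · rw [ind_of_notMem (by simpa using h)]; positivity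
  refine (Finset.sum_le_sum fun a _ => key a).trans ?_
  rw [← Finset.mul_sum, Finset.sum_add_distrib]
  have h3 : Real.exp (-(m * ε ^ 2 / 2)) = Real.exp (-(m * ε ^ 2)) * Real.exp (m * (ε ^ 2 / 2)) := by
    rw [← Real.exp_add]; congr 1; ring
  rw [h3]
  have h4 := (Real.exp_pos (-(m * ε ^ 2))).le
  rw [neg_sq] at h2
  nlinarith [mul_le_mul_of_nonneg_left (add_le_add h1 h2) h4]

/-- Croot–Sisask sampling: the translates of a single random sample of `1_B * f` along a large set
`T` approximate `1_B * f` off a small exceptional set. -/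
lemma exists_sample_translates {G : Type*} [AddCommGroup G] [Fintype G]
    (B : Finset G) (hB : B.Nonempty) (f : G → ℝ) (hf0 : ∀ x, 0 ≤ f x) (hf1 : ∀ x, f x ≤ 1)
    (m : ℕ) {ε : ℝ} (hε : 0 < ε) :
    ∃ (c : Fin m → G) (T : Finset G),
      ((#B : ℝ) / Fintype.card G) ^ m / 2 * Fintype.card G ≤ #T ∧
      ∀ t ∈ T, ∑ x, ind {x | m * ε < |∑ i, (f (x - (c i + t)) - (∑ b ∈ B, f (x - b)) / #B)|} x ≤
        4 * Real.exp (-(m * ε ^ 2 / 2)) * Fintype.card G := by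
  classical
  set N : ℝ := (Fintype.card G : ℝ) with hNdef
  have hN : 0 < N := by rw [hNdef]; exact_mod_cast Fintype.card_pos
  have hb : (0 : ℝ) < #B := by exact_mod_cast hB.card_pos
  set e := Real.exp (-(m * ε ^ 2 / 2)) with he
  have he0 : 0 < e := Real.exp_pos _
  set Q := Fintype.piFinset (fun _ : Fin m => B) with hQ
  have hQc : (#Q : ℝ) = (#B : ℝ) ^ m := by simp [hQ]
  set F : G → ℝ := fun x => (∑ b ∈ B, f (x - b)) / #B with hF
  have hF0 : ∀ x, 0 ≤ F x := fun x => div_nonneg (Finset.sum_nonneg fun _ _ => hf0 _) hb.le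
  have hF1 : ∀ x, F x ≤ 1 := fun x => by
    rw [div_le_one hb]
    exact (Finset.sum_le_sum fun b _ => hf1 (x - b)).trans (by simp)
  set bad : (Fin m → G) → ℝ := fun a =>
    ∑ x, ind {x | m * ε < |∑ i, (f (x - a i) - F x)|} x with hbad
  have hsum : ∑ a ∈ Q, bad a ≤ 2 * e * (#B : ℝ) ^ m * N := by
    simp only [hbad]
    rw [Finset.sum_comm]
    have : ∀ x, ∑ a ∈ Q, ind {x | m * ε < |∑ i, (f (x - a i) - F x)|} x ≤
        2 * e * (#B : ℝ) ^ m := by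
      intro x
      refine le_trans (le_of_eq ?_) (card_large_sample_sum_le B (fun b => f (x - b) - F x) ?_ ?_ m hε.le)
      · refine Finset.sum_congr rfl fun a _ => ?_
        by_cases h : m * ε < |∑ i, (f (x - a i) - F x)|
        · rw [ind_of_mem (by simpa using h), ind_of_mem (by simpa using h)]
        · rw [ind_of_notMem (by simpa using h), ind_of_notMem (by simpa using h)]
      · intro b
        exact abs_le.2 ⟨by linarith [hf0 (x - b), hF1 x], by linarith [hf1 (x - b), hF0 x]⟩
      · simp only [hF, Finset.sum_sub_distrib, Finset.sum_const, nsmul_eq_mul]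
        field_simp
        simp
    exact (Finset.sum_le_sum fun x _ => this x).trans (by simp [mul_comm, hNdef])
  set L := Q.filter fun a => bad a ≤ 4 * e * N with hL
  have hLc : (#B : ℝ) ^ m / 2 ≤ #L := by
    have h1 : (#(Q.filter fun a => ¬ bad a ≤ 4 * e * N) : ℝ) * (4 * e * N) ≤
        2 * e * (#B : ℝ) ^ m * N := by
      refine le_trans ?_ hsum
      rw [← nsmul_eq_mul]
      refine (Finset.card_nsmul_le_sum _ bad _ ?_).trans ?_
      · intro a ha
        exact (not_le.1 (Finset.mem_filter.1 ha).2).le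
      · exact Finset.sum_le_sum_of_subset_of_nonneg (Finset.filter_subset _ _) fun a _ _ =>
          Finset.sum_nonneg fun _ _ => ind_nonneg _ _
    have h2 : (#L : ℝ) + #(Q.filter fun a => ¬ bad a ≤ 4 * e * N) = (#B : ℝ) ^ m := by
      rw [← hQc]; exact_mod_cast Finset.card_filter_add_card_filter_not _
    have h3 : (#(Q.filter fun a => ¬ bad a ≤ 4 * e * N) : ℝ) ≤ (#B : ℝ) ^ m / 2 := by
      have : 0 < 4 * e * N := by positivity
      rw [← mul_le_mul_iff_left₀ this]
      linarith
    linarith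
  have hdc : ∑ c : Fin m → G, (#(univ.filter fun t : G => (fun i => c i + t) ∈ L) : ℝ) = N * #L := by
    have : ∀ t : G, ∑ c : Fin m → G, (if (fun i => c i + t) ∈ L then (1 : ℝ) else 0) = #L := by
      intro t
      rw [← Equiv.sum_comp (Equiv.subRight (fun _ : Fin m => t))]
      simp
    simp only [Finset.card_filter, Nat.cast_sum, Nat.cast_ite, Nat.cast_one, Nat.cast_zero]
    rw [Finset.sum_comm]
    simp [this, hNdef]
  obtain ⟨c, -, hc⟩ := Finset.exists_le_of_sum_le (s := (univ : Finset (Fin m → G)))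
    (f := fun _ => N * #L / N ^ m)
    (g := fun c => (#(univ.filter fun t : G => (fun i => c i + t) ∈ L) : ℝ)) ⟨0, by simp⟩ (by
      rw [hdc]
      simp only [Finset.sum_const, Finset.card_univ, Fintype.card_fun, Fintype.card_fin,
        nsmul_eq_mul, Nat.cast_pow]
      rw [mul_div_cancel₀ _ (by positivity)])
  refine ⟨c, _, le_trans ?_ hc, fun t ht => (Finset.mem_filter.1 (Finset.mem_filter.1 ht).2).2⟩
  rw [div_pow, le_div_iff₀ (by positivity)]
  calc _ = N * ((#B : ℝ) ^ m / 2) := by field_simp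
    _ ≤ _ := by gcongr

lemma exists_almost_periods {G : Type*} [AddCommGroup G] [Fintype G]
    (B : Finset G) (hB : B.Nonempty) (f : G → ℝ) (hf0 : ∀ x, 0 ≤ f x) (hf1 : ∀ x, f x ≤ 1)
    {m : ℕ} (hm : 0 < m) {ε : ℝ} (hε : 0 < ε) :
    ∃ (T : Finset G) (g : G → ℝ),
      ((#B : ℝ) / Fintype.card G) ^ m / 2 * Fintype.card G ≤ #T ∧
      ∀ t ∈ T, ∀ v, |(∑ b ∈ B, ∑ b' ∈ B, f (b + (v + t) - b')) / (#B : ℝ) ^ 2 - g v| ≤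
        ε + 4 * Real.exp (-(m * ε ^ 2 / 2)) / ((#B : ℝ) / Fintype.card G) := by
  obtain ⟨c, T, hT, h⟩ := exists_sample_translates B hB f hf0 hf1 m hε
  set N : ℝ := (Fintype.card G : ℝ) with hNdef
  have hN : 0 < N := by rw [hNdef]; exact_mod_cast Fintype.card_pos
  have hb : (0 : ℝ) < #B := by exact_mod_cast hB.card_pos
  have hm' : (0 : ℝ) < m := by exact_mod_cast hm
  set e := Real.exp (-(m * ε ^ 2 / 2)) with he
  set F : G → ℝ := fun x => (∑ b ∈ B, f (x - b)) / #B with hF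
  have hF0 : ∀ x, 0 ≤ F x := fun x => div_nonneg (Finset.sum_nonneg fun _ _ => hf0 _) hb.le
  have hF1 : ∀ x, F x ≤ 1 := fun x => by
    rw [div_le_one hb]
    exact (Finset.sum_le_sum fun b _ => hf1 (x - b)).trans (by simp)
  refine ⟨T, fun v => (∑ b ∈ B, (∑ i, f (b + v - c i)) / m) / #B, hT, fun t ht v => ?_⟩
  set S := {x | m * ε < |∑ i, (f (x - (c i + t)) - F x)|} with hS
  have hpt : ∀ x, |F x - (∑ i, f (x - (c i + t))) / m| ≤ ε + ind S x := by
    intro x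
    have hx : F x - (∑ i, f (x - (c i + t))) / m = -((∑ i, (f (x - (c i + t)) - F x)) / m) := by
      rw [Finset.sum_sub_distrib]
      simp
      field_simp
      ring
    rw [hx, abs_neg, abs_div, abs_of_pos hm', div_le_iff₀ hm']
    by_cases hxS : x ∈ S
    · rw [ind_of_mem hxS]
      refine (Finset.abs_sum_le_sum_abs _ _).trans ?_
      refine (Finset.sum_le_sum (g := fun _ => (1 : ℝ)) fun i _ => ?_).trans ?_
      · exact abs_le.2 ⟨by linarith [hf0 (x - (c i + t)), hF1 x],
          by linarith [hf1 (x - (c i + t)), hF0 x]⟩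
      · simp; nlinarith
    · rw [ind_of_notMem hxS, add_zero, mul_comm]
      exact not_lt.1 hxS
  have heq : (∑ b ∈ B, ∑ b' ∈ B, f (b + (v + t) - b')) / (#B : ℝ) ^ 2 -
      (∑ b ∈ B, (∑ i, f (b + v - c i)) / m) / #B =
      (∑ b ∈ B, (F (b + (v + t)) - (∑ i, f (b + (v + t) - (c i + t))) / m)) / #B := by
    rw [Finset.sum_sub_distrib, sub_div]
    congr 1
    · simp only [hF, ← Finset.sum_div]
      field_simp
    · congr 1
      refine Finset.sum_congr rfl fun b _ => ?_
      congr 1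
      refine Finset.sum_congr rfl fun i _ => ?_
      congr 1
      abel
  rw [heq, abs_div, abs_of_pos hb, div_le_iff₀ hb]
  calc _ ≤ ∑ b ∈ B, |F (b + (v + t)) - (∑ i, f (b + (v + t) - (c i + t))) / m| :=
        Finset.abs_sum_le_sum_abs _ _
    _ ≤ ∑ b ∈ B, (ε + ind S (b + (v + t))) := Finset.sum_le_sum fun b _ => hpt _
    _ = #B * ε + ∑ b ∈ B, ind S (b + (v + t)) := by
        rw [Finset.sum_add_distrib]; simp
    _ ≤ #B * ε + ∑ x, ind S x := by
        gcongr
        rw [← Equiv.sum_comp (Equiv.addRight (v + t)) (ind S)]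
        exact Finset.sum_le_sum_of_subset_of_nonneg (Finset.subset_univ _) fun _ _ _ =>
          ind_nonneg _ _
    _ ≤ #B * ε + 4 * e * N := by gcongr; exact h t ht
    _ = _ := by field_simp

lemma sum_diff_char {F V : Type*} [Field F] [Fintype F] [AddCommGroup V] [Module F V]
    (φ : Module.Dual F V) (ψ : AddChar F ℂ) (T : Finset V) (v : V) :
    ∑ t ∈ T, ∑ t' ∈ T, ψ (φ (v + t - t')) =
      ((‖∑ t ∈ T, ψ (φ t)‖ ^ 2 : ℝ) : ℂ) * ψ (φ v) := by
  rw [Complex.ofReal_pow, ← Complex.mul_conj', map_sum, Finset.sum_mul_sum]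
  simp only [← AddChar.map_neg_eq_conj, Finset.sum_mul, ← AddChar.map_add_eq_mul]
  refine Finset.sum_congr rfl fun b _ => Finset.sum_congr rfl fun b' _ => ?_
  congr 1
  simp only [map_add, map_sub]
  ring

/-- Averaging a function over its almost periods `k` times changes it little. -/
lemma norm_sub_iterated_average_le {F V : Type*} [Field F] [Fintype F] [AddCommGroup V]
    [Module F V] [Fintype (Module.Dual F V)] (ψ : AddChar F ℂ)
    (c : Module.Dual F V → ℂ) (T : Finset V) (hT : T.Nonempty) (g : V → ℂ) {δ : ℝ}
    (h : ∀ t ∈ T, ∀ v, ‖∑ φ, c φ * ψ (φ (v + t)) - g v‖ ≤ δ) (k : ℕ) (v : V) :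
    ‖∑ φ, c φ * ψ (φ v) - ∑ φ, c φ *
      (((‖∑ t ∈ T, ψ (φ t)‖ / #T) ^ 2 : ℝ) : ℂ) ^ k * ψ (φ v)‖ ≤ 2 * k * δ := by
  induction k generalizing v with
  | zero => simp
  | succ k ih =>
    have hT0 : (0 : ℝ) < #T := by exact_mod_cast hT.card_pos
    have hT' : (#T : ℂ) ≠ 0 := by exact_mod_cast hT0.ne'
    set P : V → ℂ := fun v => ∑ φ, c φ *
      (((‖∑ t ∈ T, ψ (φ t)‖ / #T) ^ 2 : ℝ) : ℂ) ^ k * ψ (φ v) with hP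
    set Φ : V → ℂ := fun v => ∑ φ, c φ * ψ (φ v) with hΦ
    have hstep : ∑ φ, c φ * (((‖∑ t ∈ T, ψ (φ t)‖ / #T) ^ 2 : ℝ) : ℂ) ^ (k + 1) * ψ (φ v) =
        (∑ t ∈ T, ∑ t' ∈ T, P (v + t - t')) / (#T : ℂ) ^ 2 := by
      have : ∑ t ∈ T, ∑ t' ∈ T, P (v + t - t') = ∑ φ, c φ *
          (((‖∑ t ∈ T, ψ (φ t)‖ / #T) ^ 2 : ℝ) : ℂ) ^ k *
            ∑ t ∈ T, ∑ t' ∈ T, ψ (φ (v + t - t')) := by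
        simp only [hP, Finset.mul_sum]
        rw [Finset.sum_comm_cycle]
      rw [this, Finset.sum_div]
      refine Finset.sum_congr rfl fun φ _ => ?_
      rw [sum_diff_char, pow_succ]
      push_cast
      field_simp
    have hpt : ∀ t ∈ T, ∀ t' ∈ T, ‖Φ v - P (v + t - t')‖ ≤ 2 * (k + 1) * δ := by
      intro t ht t' ht'
      have h1 := h t ht (v - t')
      have h2 := h t' ht' (v - t')
      have h3 := ih (v + t - t')
      rw [sub_add_cancel] at h2
      rw [show v - t' + t = v + t - t' by abel] at h1
      calc ‖Φ v - P (v + t - t')‖ = ‖(Φ v - g (v - t')) - (Φ (v + t - t') - g (v - t')) +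
            (Φ (v + t - t') - P (v + t - t'))‖ := by congr 1; ring
        _ ≤ δ + δ + 2 * k * δ :=
            (norm_add_le _ _).trans (add_le_add ((norm_sub_le _ _).trans (add_le_add h2 h1)) h3)
        _ = _ := by ring
    rw [hstep]
    have heq : Φ v - (∑ t ∈ T, ∑ t' ∈ T, P (v + t - t')) / (#T : ℂ) ^ 2 =
        (∑ t ∈ T, ∑ t' ∈ T, (Φ v - P (v + t - t'))) / (#T : ℂ) ^ 2 := by
      simp only [Finset.sum_sub_distrib, Finset.sum_const, nsmul_eq_mul]
      field_simp
    rw [heq, norm_div, norm_pow, Complex.norm_natCast, div_le_iff₀ (by positivity)]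
    refine (norm_sum_le _ _).trans ((Finset.sum_le_sum fun t ht => (norm_sum_le _ _).trans
      (Finset.sum_le_sum fun t' ht' => hpt t ht t' ht')).trans (le_of_eq ?_))
    simp only [Finset.sum_const, nsmul_eq_mul]
    push_cast
    ring

/-- A function with an absolutely summable Fourier expansion and a set `T` of almost periods is
almost invariant under the annihilator of the large spectrum of `T`. -/
lemma norm_sub_le_of_forall_large_spectrum {F V : Type*} [Field F] [Fintype F] [AddCommGroup V]
    [Module F V] [Fintype (Module.Dual F V)] (ψ : AddChar F ℂ)
    (c : Module.Dual F V → ℂ) (T : Finset V) (hT : T.Nonempty) (g : V → ℂ) {δ : ℝ}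
    (h : ∀ t ∈ T, ∀ v, ‖∑ φ, c φ * ψ (φ (v + t)) - g v‖ ≤ δ) (k : ℕ) (v : V)
    (hv : ∀ φ : Module.Dual F V, (#T : ℝ) / 2 ≤ ‖∑ t ∈ T, ψ (φ t)‖ → φ v = 0) :
    ‖∑ φ, c φ * ψ (φ v) - ∑ φ, c φ * ψ (φ 0)‖ ≤ 4 * k * δ + 2 * (1 / 4) ^ k * ∑ φ, ‖c φ‖ := by
  have h1 := norm_sub_iterated_average_le ψ c T hT g h k v
  have h2 := norm_sub_iterated_average_le ψ c T hT g h k 0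
  have hT0 : (0 : ℝ) < #T := by exact_mod_cast hT.card_pos
  set P : V → ℂ := fun v => ∑ φ, c φ *
    (((‖∑ t ∈ T, ψ (φ t)‖ / #T) ^ 2 : ℝ) : ℂ) ^ k * ψ (φ v) with hP
  set Φ : V → ℂ := fun v => ∑ φ, c φ * ψ (φ v) with hΦ
  have h3 : ‖P v - P 0‖ ≤ 2 * (1 / 4) ^ k * ∑ φ, ‖c φ‖ := by
    simp only [hP, ← Finset.sum_sub_distrib, ← mul_sub, Finset.mul_sum]
    refine (norm_sum_le _ _).trans (Finset.sum_le_sum fun φ _ => ?_)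
    rcases le_or_gt ((#T : ℝ) / 2) ‖∑ t ∈ T, ψ (φ t)‖ with hφ | hφ
    · rw [hv φ hφ, map_zero φ, sub_self, mul_zero, norm_zero]; positivity
    · have h4 : ‖ψ (φ v) - ψ (φ 0)‖ ≤ 2 := by
        refine (norm_sub_le _ _).trans ?_
        rw [AddChar.norm_apply, AddChar.norm_apply]; norm_num
      have h5 : (‖∑ t ∈ T, ψ (φ t)‖ / #T) ^ 2 ≤ 1 / 4 := by
        have : ‖∑ t ∈ T, ψ (φ t)‖ / #T ≤ 1 / 2 := by
          rw [div_le_iff₀ hT0]; linarith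
        calc _ ≤ (1 / 2 : ℝ) ^ 2 := by gcongr
          _ = _ := by norm_num
      rw [norm_mul, norm_mul, norm_pow, Complex.norm_real, Real.norm_of_nonneg (by positivity)]
      calc _ ≤ ‖c φ‖ * (1 / 4) ^ k * 2 := by gcongr
        _ = _ := by ring
  calc ‖Φ v - Φ 0‖ = ‖(Φ v - P v) - (Φ 0 - P 0) + (P v - P 0)‖ := by congr 1; ring
    _ ≤ 2 * k * δ + 2 * k * δ + 2 * (1 / 4) ^ k * ∑ φ, ‖c φ‖ :=
        (norm_add_le _ _).trans (add_le_add ((norm_sub_le _ _).trans (add_le_add h1 h2)) h3)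
    _ = _ := by ring

section Fourier

variable {F V : Type*} [Field F] [Fintype F] [AddCommGroup V] [Module F V] [Fintype V]

lemma finite_dual : Finite (Module.Dual F V) :=
  Finite.of_injective (fun f : Module.Dual F V => (f : V → F)) DFunLike.coe_injective

lemma card_dual [Fintype (Module.Dual F V)] :
    Fintype.card (Module.Dual F V) = Fintype.card V := by
  rw [Module.card_eq_pow_finrank (K := F) (V := Module.Dual F V),
    Module.card_eq_pow_finrank (K := F) (V := V), Subspace.dual_finrank_eq]

lemma sum_dual_char [Fintype (Module.Dual F V)] [DecidableEq V] {ψ : AddChar F ℂ} (hψ : ψ ≠ 1)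
    (x : V) :
    ∑ φ : Module.Dual F V, ψ (φ x) = if x = 0 then (Fintype.card V : ℂ) else 0 := by
  classical
  have h := AddChar.sum_eq_ite (ψ.compAddMonoidHom (Module.Dual.eval F V x).toAddMonoidHom)
  simp only [AddChar.compAddMonoidHom_apply, LinearMap.toAddMonoidHom_coe,
    Module.Dual.eval_apply] at h
  rw [h, card_dual]
  congr 1
  rw [eq_iff_iff]
  constructor
  · intro h0
    by_contra hx
    apply hψ
    obtain ⟨φ, hφ⟩ := Module.Projective.exists_dual_ne_zero F hx
    ext y
    simpa [hφ] using DFunLike.congr_fun h0 ((y / φ x) • φ)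
  · rintro rfl
    ext φ
    simp

lemma sum_norm_sq_char [Fintype (Module.Dual F V)] {ψ : AddChar F ℂ} (hψ : ψ ≠ 1)
    (B : Finset V) :
    ∑ φ : Module.Dual F V, ‖∑ b ∈ B, ψ (φ b)‖ ^ 2 = Fintype.card V * #B := by
  classical
  have h : ∀ φ : Module.Dual F V, ((‖∑ b ∈ B, ψ (φ b)‖ ^ 2 : ℝ) : ℂ) =
      ∑ b ∈ B, ∑ b' ∈ B, ψ (φ (b - b')) := fun φ => by
    rw [Complex.ofReal_pow, ← Complex.mul_conj', map_sum, Finset.sum_mul_sum]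
    simp only [← AddChar.map_neg_eq_conj, ← AddChar.map_add_eq_mul, map_sub, ← sub_eq_add_neg]
  have h2 : ((∑ φ : Module.Dual F V, ‖∑ b ∈ B, ψ (φ b)‖ ^ 2 : ℝ) : ℂ) = Fintype.card V * #B := by
    rw [Complex.ofReal_sum]
    simp only [h]
    rw [Finset.sum_comm]
    have h3 : ∀ b ∈ B, ∑ φ : Module.Dual F V, ∑ b' ∈ B, ψ (φ (b - b')) = Fintype.card V := by
      intro b hb
      rw [Finset.sum_comm]
      simp only [sum_dual_char hψ, sub_eq_zero]
      simp [hb]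
    rw [Finset.sum_congr rfl h3]
    simp [mul_comm]
  exact_mod_cast h2

/-- A function `1_B * 1_{-B} * f` has an absolutely summable Fourier expansion. -/
lemma exists_fourier_expansion [Fintype (Module.Dual F V)] {ψ : AddChar F ℂ} (hψ : ψ ≠ 1)
    (B : Finset V) (hB : B.Nonempty) (f : V → ℝ) (hf0 : ∀ x, 0 ≤ f x) (hf1 : ∀ x, f x ≤ 1) :
    ∃ c : Module.Dual F V → ℂ, ∑ φ, ‖c φ‖ ≤ ((#B : ℝ) / Fintype.card V)⁻¹ ∧
      ∀ v, (((∑ b ∈ B, ∑ b' ∈ B, f (b + v - b')) / (#B : ℝ) ^ 2 : ℝ) : ℂ) =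
        ∑ φ, c φ * ψ (φ v) := by
  classical
  have hN : (0 : ℝ) < Fintype.card V := by exact_mod_cast Fintype.card_pos
  have hb : (0 : ℝ) < #B := by exact_mod_cast hB.card_pos
  set fh : Module.Dual F V → ℂ := fun φ => ∑ x, (f x : ℂ) * ψ (φ (-x)) with hfh
  have hfhb : ∀ φ, ‖fh φ‖ ≤ Fintype.card V := fun φ => by
    refine (norm_sum_le _ _).trans ?_
    refine (Finset.sum_le_sum (g := fun _ => (1 : ℝ)) fun x _ => ?_).trans (by simp)
    rw [norm_mul, AddChar.norm_apply, mul_one, Complex.norm_real, Real.norm_of_nonneg (hf0 x)]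
    exact hf1 x
  have hinv : ∀ z, ∑ φ, fh φ * ψ (φ z) = Fintype.card V * f z := fun z => by
    simp only [hfh, Finset.sum_mul, mul_assoc, ← AddChar.map_add_eq_mul, ← map_add]
    rw [Finset.sum_comm]
    simp only [← Finset.mul_sum, sum_dual_char hψ, neg_add_eq_zero]
    simp [mul_comm]
  refine ⟨fun φ => (Fintype.card V * (#B : ℂ) ^ 2)⁻¹ *
    (fh φ * ((∑ b ∈ B, ψ (φ b)) * ∑ b ∈ B, ψ (φ (-b)))), ?_, fun v => ?_⟩
  · have h1 : ∀ φ : Module.Dual F V, ‖(Fintype.card V * (#B : ℂ) ^ 2)⁻¹ *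
        (fh φ * ((∑ b ∈ B, ψ (φ b)) * ∑ b ∈ B, ψ (φ (-b))))‖ ≤
        ((#B : ℝ) ^ 2)⁻¹ * ‖∑ b ∈ B, ψ (φ b)‖ ^ 2 := by
      intro φ
      have h2 : ‖∑ b ∈ B, ψ (φ (-b))‖ = ‖∑ b ∈ B, ψ (φ b)‖ := by
        simp only [map_neg, AddChar.map_neg_eq_conj, ← map_sum, RCLike.norm_conj]
      rw [norm_mul, norm_mul, norm_mul, h2, norm_inv, norm_mul, norm_pow]
      simp only [Complex.norm_natCast]
      calc _ ≤ (Fintype.card V * (#B : ℝ) ^ 2)⁻¹ * (Fintype.card V *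
            (‖∑ b ∈ B, ψ (φ b)‖ * ‖∑ b ∈ B, ψ (φ b)‖)) := by gcongr; exact hfhb φ
        _ = _ := by field_simp
    refine (Finset.sum_le_sum fun φ _ => h1 φ).trans (le_of_eq ?_)
    rw [← Finset.mul_sum, sum_norm_sq_char hψ]
    field_simp
  · have hb' : (#B : ℂ) ≠ 0 := by exact_mod_cast hb.ne'
    have hN' : (Fintype.card V : ℂ) ≠ 0 := by exact_mod_cast hN.ne'
    have h1 : ∀ φ : Module.Dual F V, (Fintype.card V * (#B : ℂ) ^ 2)⁻¹ *
        (fh φ * ((∑ b ∈ B, ψ (φ b)) * ∑ b ∈ B, ψ (φ (-b)))) * ψ (φ v) =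
        (Fintype.card V * (#B : ℂ) ^ 2)⁻¹ *
          ∑ b ∈ B, ∑ b' ∈ B, fh φ * ψ (φ (b + v - b')) := by
      intro φ
      rw [mul_assoc, mul_assoc, Finset.sum_mul_sum]
      simp only [Finset.mul_sum, Finset.sum_mul]
      refine Finset.sum_congr rfl fun b _ => Finset.sum_congr rfl fun b' _ => ?_
      rw [show b + v - b' = b + -b' + v by abel, map_add φ, map_add φ, AddChar.map_add_eq_mul,
        AddChar.map_add_eq_mul, mul_assoc]
    simp only [h1]
    have hswap : ∑ φ : Module.Dual F V, ∑ b ∈ B, ∑ b' ∈ B, fh φ * ψ (φ (b + v - b')) =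
        ∑ b ∈ B, ∑ φ : Module.Dual F V, ∑ b' ∈ B, fh φ * ψ (φ (b + v - b')) := Finset.sum_comm
    rw [← Finset.mul_sum, hswap]
    have h2 : ∀ b ∈ B, ∑ φ : Module.Dual F V, ∑ b' ∈ B, fh φ * ψ (φ (b + v - b')) =
        Fintype.card V * ∑ b' ∈ B, (f (b + v - b') : ℂ) := by
      intro b _
      rw [Finset.sum_comm]
      simp only [hinv, Finset.mul_sum]
    rw [Finset.sum_congr rfl h2, ← Finset.mul_sum]
    push_cast
    field_simp

end Fourier

lemma sum_comp_eq_of_surjective {V Y : Type*} [AddCommGroup V] [Fintype V] [AddCommGroup Y]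
    [Fintype Y] (L : V →+ Y) (hL : Function.Surjective L) (g : Y → ℝ) :
    (Fintype.card Y : ℝ) * ∑ x, g (L x) = Fintype.card V * ∑ y, g y := by
  have h1 : ∀ y : Y, ∑ x, g (y + L x) = ∑ x, g (L x) := fun y => by
    obtain ⟨z, rfl⟩ := hL y
    simp only [← map_add]
    exact Equiv.sum_comp (Equiv.addLeft z) (fun x => g (L x))
  have h2 : ∀ x : V, ∑ y, g (y + L x) = ∑ y, g y := fun x =>
    Equiv.sum_comp (Equiv.addRight (L x)) g
  have h3 : ∑ y, ∑ x, g (y + L x) = ∑ x, ∑ y, g (y + L x) := Finset.sum_comm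
  simpa [h1, h2] using h3

lemma surjective_pi_of_linearIndependent {F V : Type*} [Field F] [AddCommGroup V] [Module F V]
    {r : ℕ} {φ : Fin r → Module.Dual F V} (h : LinearIndependent F φ) :
    Function.Surjective (LinearMap.pi φ) := by
  rw [← LinearMap.range_eq_top]
  by_contra hne
  obtain ⟨f, hf, hle⟩ := Submodule.exists_le_ker_of_lt_top _ (lt_top_iff_ne_top.2 hne)
  apply hf
  have hfe : ∀ y : Fin r → F, f y = ∑ i, y i * f (Pi.single i 1) := fun y => by
    conv_lhs => rw [pi_eq_sum_univ' y]
    simp only [map_sum, map_smul, smul_eq_mul]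
  have h0 : ∑ i, f (Pi.single i 1) • φ i = 0 := by
    ext x
    have : f (LinearMap.pi φ x) = 0 := hle (LinearMap.mem_range_self _ x)
    rw [hfe] at this
    simpa [mul_comm] using this
  have h1 := Fintype.linearIndependent_iff.1 h _ h0
  ext i
  simpa using h1 i

/-- Chang's inequality for linearly independent characters. -/
lemma card_le_of_large_char_sums {F V : Type*} [Field F] [Fintype F] [AddCommGroup V] [Module F V]
    [Fintype V] {ψ : AddChar F ℂ} (hψ : ψ ≠ 0) (T : Finset V) (hT : T.Nonempty) {r : ℕ}
    {φ : Fin r → Module.Dual F V} (h : LinearIndependent F φ)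
    (hφ : ∀ i, (#T : ℝ) / 2 ≤ ‖∑ t ∈ T, ψ (φ i t)‖) :
    (r : ℝ) ≤ 8 * Real.log (Fintype.card V / #T) := by
  classical
  have hN : (0 : ℝ) < Fintype.card V := by
    have := hT.card_pos.trans_le (Finset.card_le_univ T)
    exact_mod_cast this
  have hT0 : (0 : ℝ) < #T := by exact_mod_cast hT.card_pos
  have hF : (0 : ℝ) < Fintype.card F := by exact_mod_cast Fintype.card_pos
  have hu : ∀ i, ∃ u : ℂ, ‖u‖ = 1 ∧ u * ∑ t ∈ T, ψ (φ i t) = ‖∑ t ∈ T, ψ (φ i t)‖ := by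
    intro i
    set z := ∑ t ∈ T, ψ (φ i t)
    have hz : ‖z‖ ≠ 0 := ((half_pos hT0).trans_le (hφ i)).ne'
    have hz' : (‖z‖ : ℂ) ≠ 0 := by exact_mod_cast hz
    refine ⟨(starRingEnd ℂ) z / ‖z‖, by simp [hz], ?_⟩
    rw [div_mul_eq_mul_div, Complex.conj_mul', sq, mul_div_assoc, div_self hz', mul_one]
  choose u hu1 hu2 using hu
  set X : Fin r → F → ℝ := fun i y => (u i * ψ y).re with hX
  have hX1 : ∀ i y, |X i y| ≤ 1 := fun i y => by
    refine (Complex.abs_re_le_norm _).trans ?_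
    rw [norm_mul, hu1, AddChar.norm_apply, one_mul]
  have hX0 : ∀ i, ∑ y, X i y = 0 := fun i => by
    simp only [hX, ← Complex.re_sum, ← Finset.mul_sum]
    rw [AddChar.sum_eq_zero_iff_ne_zero.2 hψ]
    simp
  have hXT : ∀ i, (#T : ℝ) / 2 ≤ ∑ t ∈ T, X i (φ i t) := fun i => by
    simp only [hX, ← Complex.re_sum, ← Finset.mul_sum, hu2, Complex.ofReal_re]
    exact hφ i
  have hmgf : ∑ x : V, Real.exp (1 / 2 * ∑ i, X i (φ i x)) ≤
      Fintype.card V * Real.exp (r * (1 / 8)) := by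
    have h1 := sum_comp_eq_of_surjective (LinearMap.pi φ).toAddMonoidHom
      (surjective_pi_of_linearIndependent h) (fun y => Real.exp (1 / 2 * ∑ i, X i (y i)))
    simp only [LinearMap.toAddMonoidHom_coe, LinearMap.pi_apply] at h1
    have h2 : ∑ y : Fin r → F, Real.exp (1 / 2 * ∑ i, X i (y i)) ≤
        (Fintype.card F : ℝ) ^ r * Real.exp (r * (1 / 8)) := by
      simp_rw [Finset.mul_sum, Real.exp_sum]
      rw [← Fintype.piFinset_univ, ← Finset.prod_univ_sum (fun _ : Fin r => (univ : Finset F))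
        (fun i y => Real.exp (1 / 2 * X i y)), Real.exp_nat_mul, ← mul_pow]
      refine (Finset.prod_le_prod (fun _ _ => Finset.sum_nonneg fun _ _ => (Real.exp_pos _).le)
        fun i _ => sum_exp_le_of_sum_eq_zero univ (X i) (hX1 i) (hX0 i) (1 / 2)).trans ?_
      simp only [Finset.prod_const, Finset.card_univ, Fintype.card_fin]
      norm_num
    rw [Fintype.card_fun, Fintype.card_fin, Nat.cast_pow] at h1
    have h3 : (0 : ℝ) < (Fintype.card F : ℝ) ^ r := by positivity
    rw [← mul_le_mul_iff_right₀ h3, h1]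
    calc _ ≤ (Fintype.card V : ℝ) * ((Fintype.card F : ℝ) ^ r * Real.exp (r * (1 / 8))) := by gcongr
      _ = _ := by ring
  have hjensen := convexOn_exp.map_sum_le (t := T) (w := fun _ => (#T : ℝ)⁻¹)
    (p := fun x => 1 / 2 * ∑ i, X i (φ i x)) (fun _ _ => by positivity)
    (by simp [hT0.ne']) (fun _ _ => Set.mem_univ _)
  simp only [smul_eq_mul, ← Finset.mul_sum] at hjensen
  have hlow : (r : ℝ) / 4 ≤ (#T : ℝ)⁻¹ * (1 / 2 * ∑ x ∈ T, ∑ i, X i (φ i x)) := by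
    rw [Finset.sum_comm]
    have : ∑ _i : Fin r, (#T : ℝ) / 2 ≤ ∑ i, ∑ t ∈ T, X i (φ i t) :=
      Finset.sum_le_sum fun i _ => hXT i
    simp only [Finset.sum_const, Finset.card_univ, Fintype.card_fin, nsmul_eq_mul] at this
    rw [inv_mul_eq_div, le_div_iff₀ hT0]
    linarith
  have hfin : Real.exp (r / 4) ≤ Fintype.card V / #T * Real.exp (r * (1 / 8)) := by
    refine (Real.exp_le_exp.2 hlow).trans (hjensen.trans ?_)
    rw [inv_mul_eq_div, div_mul_eq_mul_div]
    gcongr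
    exact (Finset.sum_le_sum_of_subset_of_nonneg (Finset.subset_univ _) fun _ _ _ =>
      (Real.exp_pos _).le).trans hmgf
  have hlog := Real.log_le_log (Real.exp_pos _) hfin
  rw [Real.log_mul (by positivity) (Real.exp_pos _).ne', Real.log_exp, Real.log_exp] at hlog
  linarith

/-- The annihilator of the large spectrum of `T` has small codimension. -/
lemma exists_annihilator_large_spectrum {F V : Type*} [Field F] [Fintype F] [AddCommGroup V]
    [Module F V] [Fintype V] {ψ : AddChar F ℂ} (hψ : ψ ≠ 0) (T : Finset V) (hT : T.Nonempty) :
    ∃ W : Submodule F V,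
      (Module.finrank F V : ℝ) - Module.finrank F W ≤ 8 * Real.log (Fintype.card V / #T) ∧
      ∀ v ∈ W, ∀ φ : Module.Dual F V, (#T : ℝ) / 2 ≤ ‖∑ t ∈ T, ψ (φ t)‖ → φ v = 0 := by
  set S : Set (Module.Dual F V) := {φ | (#T : ℝ) / 2 ≤ ‖∑ t ∈ T, ψ (φ t)‖} with hS
  obtain ⟨φ, hφS, -, hφ⟩ := Submodule.exists_fun_fin_finrank_span_eq F S
  refine ⟨(Submodule.span F S).dualCoannihilator, ?_, fun v hv φ hφ => ?_⟩
  · have h1 := Subspace.finrank_add_finrank_dualCoannihilator_eq (Submodule.span F S)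
    have h2 := card_le_of_large_char_sums hψ T hT hφ hφS
    have h3 : (Module.finrank F (Submodule.span F S) : ℝ) +
      Module.finrank F (Submodule.span F S).dualCoannihilator = Module.finrank F V := by
        exact_mod_cast h1
    linarith
  · exact (Submodule.mem_dualCoannihilator v).1 hv φ (Submodule.subset_span hφ)

/-- If `B` is dense then the distribution of `b - b'` with `b, b' ∈ B` is almost invariant under
translation by a subspace of small codimension. -/
lemma exists_submodule_almost_invariant {F V : Type*} [Field F] [Fintype F] [AddCommGroup V]
    [Module F V] [Fintype V] (B : Finset V) (f : V → ℝ)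
    (hf0 : ∀ x, 0 ≤ f x) (hf1 : ∀ x, f x ≤ 1) {D : ℝ} (hD : 1 ≤ D)
    (hB : Real.exp (-D) * Fintype.card V ≤ #B) :
    ∃ W : Submodule F V,
      (Module.finrank F V : ℝ) - Module.finrank F W ≤ 10 ^ 14 * D ^ 4 ∧
      ∀ v ∈ W, |(∑ b ∈ B, ∑ b' ∈ B, f (b + v - b')) / (#B : ℝ) ^ 2 -
        (∑ b ∈ B, ∑ b' ∈ B, f (b - b')) / (#B : ℝ) ^ 2| ≤ 1 / 100 := by
  have := finite_dual (F := F) (V := V)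
  have := Fintype.ofFinite (Module.Dual F V)
  obtain ⟨ψ, hψ1⟩ := AddChar.exists_apply_ne_zero.2 (one_ne_zero (α := F))
  have hψ : ψ ≠ 1 := fun h => hψ1 (by simp [h])
  set N : ℝ := (Fintype.card V : ℝ) with hNdef
  have hN : 0 < N := by rw [hNdef]; exact_mod_cast Fintype.card_pos
  have hb : (0 : ℝ) < #B := (by positivity : 0 < Real.exp (-D) * N).trans_le hB
  have hBne : B.Nonempty := Finset.card_pos.1 (by exact_mod_cast hb)
  set β : ℝ := #B / N with hβ
  have hβ0 : 0 < β := by positivity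
  have hβD : Real.exp (-D) ≤ β := by rwa [hβ, le_div_iff₀ hN]
  have hβinv : β⁻¹ ≤ Real.exp D := by
    rw [← inv_inv (Real.exp D), ← Real.exp_neg]
    gcongr
  set k : ℕ := ⌈D⌉₊ + 5 with hk
  have hDk : D ≤ (⌈D⌉₊ : ℝ) := Nat.le_ceil D
  have hkD : (k : ℝ) ≤ 7 * D := by
    have := Nat.ceil_lt_add_one (by linarith : 0 ≤ D)
    rw [hk]; push_cast; linarith
  have hk0 : (0 : ℝ) < k := by rw [hk]; positivity
  set ε : ℝ := 1 / (1600 * k) with hεdef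
  have hε : 0 < ε := by positivity
  have hεinv : 1 / ε ≤ 11200 * D := by
    rw [hεdef, one_div_one_div]; linarith
  set m : ℕ := ⌈2 * (1 / ε) ^ 2 * (D + 4 * (1 / ε))⌉₊ with hmdef
  have hm1 : 2 * (1 / ε) ^ 2 * (D + 4 * (1 / ε)) ≤ m := Nat.le_ceil _
  have hm0 : (0 : ℝ) < m := lt_of_lt_of_le (by positivity) hm1
  have hm2 : (m : ℝ) ≤ 2 * (11200 * D) ^ 2 * (D + 4 * (11200 * D)) + 1 := by
    refine (Nat.ceil_lt_add_one (by positivity)).le.trans ?_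
    gcongr
  obtain ⟨T, g, hT, hTg⟩ := exists_almost_periods B hBne f hf0 hf1 (by exact_mod_cast hm0 : 0 < m) hε
  have hTpos : (0 : ℝ) < #T := (by positivity : 0 < β ^ m / 2 * N).trans_le hT
  have hTne : T.Nonempty := Finset.card_pos.1 (by exact_mod_cast hTpos)
  have herr : 4 * Real.exp (-(m * ε ^ 2 / 2)) / β ≤ ε := by
    have h1 : D + 4 * (1 / ε) ≤ m * ε ^ 2 / 2 := by
      have h := mul_le_mul_of_nonneg_right hm1 (by positivity : 0 ≤ ε ^ 2 / 2)
      have e : 2 * (1 / ε) ^ 2 * (D + 4 * (1 / ε)) * (ε ^ 2 / 2) = D + 4 * (1 / ε) := by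
        field_simp
      linarith
    have h2 : 4 * (1 / ε) ≤ Real.exp (4 * (1 / ε)) := by
      have := Real.add_one_le_exp (4 * (1 / ε)); linarith
    rw [div_le_iff₀ hβ0]
    calc 4 * Real.exp (-(m * ε ^ 2 / 2)) ≤ 4 * Real.exp (-(D + 4 * (1 / ε))) := by gcongr
      _ = 4 * (Real.exp (4 * (1 / ε)))⁻¹ * Real.exp (-D) := by
          rw [neg_add, Real.exp_add, Real.exp_neg (4 * (1 / ε))]; ring
      _ ≤ 4 * (4 * (1 / ε))⁻¹ * β := by gcongr
      _ = ε * β := by field_simp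
  obtain ⟨c, hc, hΦ⟩ := exists_fourier_expansion hψ B hBne f hf0 hf1
  obtain ⟨W, hW, hWv⟩ := exists_annihilator_large_spectrum hψ T hTne
  refine ⟨W, hW.trans ?_, fun v hv => ?_⟩
  · have h1 : Real.log (N / #T) ≤ m * D + 1 := by
      have h2 : N / #T ≤ 2 * Real.exp D ^ m := by
        rw [div_le_iff₀ hTpos]
        calc N = 2 * (β⁻¹) ^ m * (β ^ m / 2 * N) := by
              have : β⁻¹ ^ m * β ^ m = 1 := by
                rw [← mul_pow, inv_mul_cancel₀ hβ0.ne', one_pow]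
              linear_combination -N * this
          _ ≤ 2 * Real.exp D ^ m * #T := by gcongr
      have h3 := Real.log_le_log (by positivity) h2
      rw [Real.log_mul (by norm_num) (by positivity), Real.log_pow, Real.log_exp] at h3
      linarith [Real.log_two_lt_d9]
    have hD2 : D * D ^ 3 = D ^ 4 := by ring
    have hD3 : 1 ≤ D ^ 4 := one_le_pow₀ hD
    have hD4 : D ≤ D ^ 4 := by
      simpa using pow_le_pow_right₀ hD (by norm_num : 1 ≤ 4)
    have h4 : m * D ≤ (2 * (11200 * D) ^ 2 * (D + 4 * (11200 * D)) + 1) * D := by gcongr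
    nlinarith
  · have h := norm_sub_le_of_forall_large_spectrum ψ c T hTne (fun v => (g v : ℂ))
      (δ := ε + 4 * Real.exp (-(m * ε ^ 2 / 2)) / β) (fun t ht v => by
        rw [← hΦ, ← Complex.ofReal_sub, Complex.norm_real]
        exact hTg t ht v) k v (hWv v hv)
    rw [← hΦ, ← hΦ, ← Complex.ofReal_sub, Complex.norm_real, Real.norm_eq_abs] at h
    simp only [add_zero] at h
    refine h.trans ?_
    have h5 : 4 * k * (ε + 4 * Real.exp (-(m * ε ^ 2 / 2)) / β) ≤ 1 / 200 := by
      calc _ ≤ 4 * k * (ε + ε) := by gcongr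
        _ = 1 / 200 := by rw [hεdef]; field_simp; norm_num
    have h6 : 2 * (1 / 4) ^ k * ∑ φ, ‖c φ‖ ≤ 1 / 200 := by
      have h7 : Real.exp D ≤ 4 ^ ⌈D⌉₊ := by
        calc Real.exp D ≤ Real.exp ⌈D⌉₊ := by gcongr
          _ = Real.exp 1 ^ ⌈D⌉₊ := by rw [← Real.exp_nat_mul, mul_one]
          _ ≤ 4 ^ ⌈D⌉₊ := by
            gcongr
            linarith [Real.exp_one_lt_d9]
      calc 2 * (1 / 4) ^ k * ∑ φ, ‖c φ‖ ≤ 2 * (1 / 4) ^ k * 4 ^ ⌈D⌉₊ := by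
            gcongr
            exact hc.trans (hβinv.trans h7)
        _ = 2 * (1 / 4) ^ 5 := by
            rw [hk, pow_add, mul_assoc, mul_right_comm, ← mul_pow]; norm_num
        _ ≤ 1 / 200 := by norm_num
    linarith

lemma sum_comp_sub_eq_sum_mul_diffCount {G : Type*} [AddCommGroup G] [Fintype G] (B : Finset G)
    (w : G → ℝ) : ∑ b ∈ B, ∑ b' ∈ B, w (b - b') = ∑ x, w x * diffCount B x := by
  have : ∀ b', ∑ x, w x * (ind (B : Set G) b' * ind (B : Set G) (b' + x)) =
      ind (B : Set G) b' * ∑ b ∈ B, w (b - b') := fun b' => by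
    rw [← sum_ind_mul B, Finset.mul_sum, ← Equiv.sum_comp (Equiv.subRight b')]
    refine Finset.sum_congr rfl fun b _ => ?_
    simp only [Equiv.subRight_apply, add_sub_cancel]
    ring
  calc ∑ b ∈ B, ∑ b' ∈ B, w (b - b')
      = ∑ b', ind (B : Set G) b' * ∑ b ∈ B, w (b - b') := by rw [Finset.sum_comm, sum_ind_mul]
    _ = ∑ b', ∑ x, w x * (ind (B : Set G) b' * ind (B : Set G) (b' + x)) := by simp_rw [this]
    _ = ∑ x, w x * diffCount B x := by
        rw [Finset.sum_comm]
        simp_rw [diffCount, Finset.mul_sum]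

/-- If a dense set `A` has `A + A` not almost everything, then `A` has increased density on some
coset of a subspace of small codimension. -/
lemma exists_density_increment {F V : Type*} [Field F] [Fintype F] [AddCommGroup V]
    [Module F V] [Fintype V] [DecidableEq V] (A : Finset V) {τ d : ℝ} (hτ0 : 0 < τ)
    (hτ : τ ≤ 1 / 2) (hd : 1 ≤ d) (hA : (2 : ℝ) ^ (-d) * Fintype.card V ≤ #A)
    (h : (#(A + A) : ℝ) ≤ (1 - τ) * Fintype.card V) :
    ∃ (W : Submodule F V) (θ : V),
      (Module.finrank F V : ℝ) - Module.finrank F W ≤ 10 ^ 23 * d ^ 4 * Real.log (1 / τ) ^ 4 ∧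
      106 / 100 * ((#A : ℝ) / Fintype.card V) * ∑ x, ind (W : Set V) x ≤
        ∑ x ∈ A, ind (W : Set V) (x - θ) := by
  set L : ℝ := Real.log (1 / τ) with hL
  have hL1 : Real.log 2 ≤ L := Real.log_le_log (by norm_num) (by
    rw [le_div_iff₀ hτ0]; linarith)
  have hlog2 := Real.log_two_gt_d9
  have hlog2' := Real.log_two_lt_d9
  have hL0 : 0 < L := by linarith
  have hdL : L ≤ d * L := le_mul_of_one_le_left hL0.le hd
  set N : ℝ := (Fintype.card V : ℝ) with hNdef
  have hN : 0 < N := by rw [hNdef]; exact_mod_cast Fintype.card_pos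
  have ha : (0 : ℝ) < #A := (by positivity : 0 < (2 : ℝ) ^ (-d) * N).trans_le hA
  have hAne : A.Nonempty := Finset.card_pos.1 (by exact_mod_cast ha)
  set p : ℕ := 2 * ⌈15 * L⌉₊ with hp
  have hceil : 15 * L ≤ (⌈15 * L⌉₊ : ℝ) := Nat.le_ceil _
  have hceil' : (⌈15 * L⌉₊ : ℝ) ≤ 15 * L + 1 := (Nat.ceil_lt_add_one (by positivity)).le
  have hp' : (p : ℝ) = 2 * (⌈15 * L⌉₊ : ℝ) := by rw [hp]; push_cast; ring
  have hp20 : 20 ≤ p := by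
    have : (20 : ℝ) ≤ p := by rw [hp']; linarith
    exact_mod_cast this
  have hpτ : (1 / 2 : ℝ) ^ p ≤ τ := by
    rw [← Real.log_le_log_iff (by positivity) hτ0, Real.log_pow, one_div, Real.log_inv]
    have : Real.log τ = -L := by rw [hL, one_div, Real.log_inv, neg_neg]
    rw [this]
    nlinarith
  obtain ⟨B, hB, hBS⟩ := exists_set_popular_differences A hAne h (even_two_mul _) hp20 hpτ
  set S : Set V := {x | 11 / 10 * ((#A : ℝ) ^ 2 / N) < diffCount A x} with hS
  have hBD : Real.exp (-(150 * (d * L))) * N ≤ #B := by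
    refine le_trans ?_ hB
    gcongr
    have h300 : Real.exp (-6) ≤ 1 / 300 := by
      rw [Real.exp_neg, ← one_div]
      gcongr
      calc (300 : ℝ) ≤ 2.7 ^ 6 := by norm_num
        _ ≤ Real.exp 1 ^ 6 := by gcongr; linarith [Real.exp_one_gt_d9]
        _ = Real.exp 6 := by rw [← Real.exp_nat_mul]; norm_num
    have hα : (2 : ℝ) ^ (-d) ≤ #A / N := by rwa [le_div_iff₀ hN]
    calc Real.exp (-(150 * (d * L))) ≤ Real.exp (-6 + Real.log 2 * (-d) * (4 * p : ℕ)) := by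
          apply Real.exp_le_exp.2
          push_cast
          rw [hp']
          have : Real.log 2 * d * (⌈15 * L⌉₊ : ℝ) ≤ 1 * d * (15 * L + 1) := by
            gcongr; linarith
          have : d * 0.69 ≤ d * L := by gcongr; linarith
          nlinarith
      _ = Real.exp (-6) * ((2 : ℝ) ^ (-d)) ^ (4 * p) := by
          rw [Real.exp_add, Real.rpow_def_of_pos (by norm_num), ← Real.exp_nat_mul,
            mul_comm _ ((4 * p : ℕ) : ℝ)]
      _ ≤ 1 / 300 * (#A / N) ^ (4 * p) := by gcongr
  obtain ⟨W, hW, hΦ⟩ := exists_submodule_almost_invariant (F := F) B (ind Sᶜ) (ind_nonneg _)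
    (ind_le_one _) (by linarith : 1 ≤ 150 * (d * L)) hBD
  have hb : (0 : ℝ) < #B := (by positivity : 0 < Real.exp (-(150 * (d * L))) * N).trans_le hBD
  have hBne : B.Nonempty := Finset.card_pos.1 (by exact_mod_cast hb)
  set M : ℝ := ∑ x, ind (W : Set V) x with hM
  obtain ⟨b, hbB, b', hbB', hbb⟩ : ∃ b ∈ B, ∃ b' ∈ B,
      ∑ v, ind (W : Set V) v * ind Sᶜ (b + v - b') ≤ 2 / 100 * M := by
    by_contra! hcon
    have h1 : ∀ v, ind (W : Set V) v * ∑ b ∈ B, ∑ b' ∈ B, ind Sᶜ (b + v - b') ≤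
        ind (W : Set V) v * (2 / 100 * (#B : ℝ) ^ 2) := fun v => by
      by_cases hv : v ∈ W
      · refine mul_le_mul_of_nonneg_left ?_ (ind_nonneg _ _)
        have h2 := (abs_le.1 (hΦ v hv)).2
        rw [← sub_div, div_le_iff₀ (by positivity), sum_comp_sub_eq_sum_mul_diffCount B] at h2
        linarith
      · simp [ind_of_notMem (A := (W : Set V)) (x := v) hv]
    have h2 := Finset.sum_le_sum fun v (_ : v ∈ Finset.univ) => h1 v
    rw [← Finset.sum_mul, ← hM] at h2
    have h3 : ∑ b ∈ B, ∑ b' ∈ B, ∑ v, ind (W : Set V) v * ind Sᶜ (b + v - b') =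
        ∑ v, ind (W : Set V) v * ∑ b ∈ B, ∑ b' ∈ B, ind Sᶜ (b + v - b') := by
      simp_rw [Finset.mul_sum]
      exact (Finset.sum_congr rfl fun _ _ => Finset.sum_comm).trans Finset.sum_comm
    have h4 : ∑ b ∈ B, ∑ b' ∈ B, 2 / 100 * M <
        ∑ b ∈ B, ∑ b' ∈ B, ∑ v, ind (W : Set V) v * ind Sᶜ (b + v - b') :=
      Finset.sum_lt_sum_of_nonempty hBne fun b hb =>
        Finset.sum_lt_sum_of_nonempty hBne fun b' hb' => hcon b hb b' hb'
    rw [h3] at h4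
    simp only [Finset.sum_const, nsmul_eq_mul] at h4
    linarith
  have hu : 98 / 100 * M ≤ ∑ v, ind (W : Set V) v * ind S (b + v - b') := by
    have h1 : ∀ v, ind (W : Set V) v * ind S (b + v - b') =
        ind (W : Set V) v - ind (W : Set V) v * ind Sᶜ (b + v - b') := fun v => by
      have : ind S (b + v - b') = 1 - ind Sᶜ (b + v - b') := by
        by_cases hx : b + v - b' ∈ S <;> simp [ind, hx]
      rw [this]; ring
    simp_rw [h1, Finset.sum_sub_distrib]
    linarith
  have hdc : 11 / 10 * ((#A : ℝ) ^ 2 / N) * (98 / 100 * M) ≤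
      ∑ y ∈ A, ∑ v, ind (W : Set V) v * ind (A : Set V) (y + (b + v - b')) := by
    calc 11 / 10 * ((#A : ℝ) ^ 2 / N) * (98 / 100 * M)
        ≤ 11 / 10 * ((#A : ℝ) ^ 2 / N) * ∑ v, ind (W : Set V) v * ind S (b + v - b') := by gcongr
      _ ≤ ∑ v, ind (W : Set V) v * diffCount A (b + v - b') := by
          rw [Finset.mul_sum]
          refine Finset.sum_le_sum fun v _ => ?_
          rw [mul_left_comm]
          refine mul_le_mul_of_nonneg_left ?_ (ind_nonneg _ _)
          by_cases hx : b + v - b' ∈ S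
          · rw [ind_of_mem hx, mul_one]; exact hx.le
          · rw [ind_of_notMem hx, mul_zero]; exact diffCount_nonneg _ _
      _ = _ := by
          simp_rw [diffCount, sum_ind_mul, Finset.mul_sum]
          exact Finset.sum_comm
  obtain ⟨y, hyA, hy⟩ : ∃ y ∈ A, 11 / 10 * ((#A : ℝ) / N) * (98 / 100 * M) ≤
      ∑ v, ind (W : Set V) v * ind (A : Set V) (y + (b + v - b')) := by
    apply Finset.exists_le_of_sum_le hAne
    rw [Finset.sum_const, nsmul_eq_mul]
    refine le_trans (le_of_eq ?_) hdc
    ring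
  refine ⟨W, y + (b - b'), hW.trans (le_of_lt ?_), ?_⟩
  · have : 0 < (d * L) ^ 4 := by positivity
    calc 10 ^ 14 * (150 * (d * L)) ^ 4 = (10 ^ 14 * 150 ^ 4) * (d * L) ^ 4 := by ring
      _ < 10 ^ 23 * (d * L) ^ 4 := by gcongr; norm_num
      _ = _ := by ring
  · have hM0 : 0 ≤ M := Finset.sum_nonneg fun _ _ => ind_nonneg _ _
    have h1 : ∑ x ∈ A, ind (W : Set V) (x - (y + (b - b'))) =
        ∑ v, ind (W : Set V) v * ind (A : Set V) (y + (b + v - b')) := by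
      rw [← sum_ind_mul, ← Equiv.sum_comp (Equiv.addRight (y + (b - b')))]
      refine Finset.sum_congr rfl fun v _ => ?_
      simp only [Equiv.coe_addRight, add_sub_cancel_right]
      rw [mul_comm]
      congr 2
      abel
    rw [h1]
    refine le_trans ?_ hy
    have : 0 ≤ (#A : ℝ) / N * M := by positivity
    nlinarith

lemma ncard_affineSubspace_eq_card_direction {F V : Type*} [Field F] [AddCommGroup V]
    [Module F V] (S : AffineSubspace F V) {x : V} (hx : x ∈ S) :
    (S : Set V).ncard = Nat.card S.direction := by
  have h := AffineSubspace.coe_direction_eq_vsub_set_right hx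
  change _ = (S.direction : Set V).ncard
  rw [h]
  exact (Set.ncard_image_of_injective _ (vsub_left_injective x)).symm

lemma exp_lt_two_of_le_half {x : ℝ} (hx : x ≤ 1 / 2) : Real.exp x < 2 := by
  rw [← Real.lt_log_iff_exp_lt (by norm_num)]
  linarith [Real.log_two_gt_d9]

/-- The number of points of `A` on the coset `θ + W`. -/
noncomputable def cosetCount {F V : Type*} [Field F] [AddCommGroup V] [Module F V] (A : Finset V)
    (θ : V) (W : Submodule F V) : ℝ :=
  ∑ x ∈ A, ind (W : Set V) (x - θ)

lemma cosetCount_mono {F V : Type*} [Field F] [AddCommGroup V] [Module F V] {A B : Finset V}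
    (h : B ⊆ A) (θ : V) (W : Submodule F V) : cosetCount B θ W ≤ cosetCount A θ W :=
  Finset.sum_le_sum_of_subset_of_nonneg h fun _ _ _ => ind_nonneg _ _

lemma cosetCount_eq_card {F V : Type*} [Field F] [AddCommGroup V] [Module F V] {A : Finset V}
    {θ : V} {W : Submodule F V} (h : ∀ x ∈ A, x - θ ∈ W) : cosetCount A θ W = #A := by
  rw [cosetCount, Finset.sum_congr rfl fun x hx => ind_of_mem (h x hx)]
  simp

lemma sum_ind_submodule {F V : Type*} [Field F] [AddCommGroup V] [Module F V] [Fintype V]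
    (W : Submodule F V) : ∑ x, ind (W : Set V) x = Nat.card W := by
  classical
  have : (W : Set V) = ((W : Set V).toFinset : Set V) := by simp
  rw [this, sum_ind, Set.toFinset_card, Nat.card_eq_fintype_card]
  rfl

/-- A dense subset of `V` has a nonempty part `A'` with the doubled set `A' + A'` filling almost
all of a translate of the affine span of `A'`, which has small codimension. -/
lemma exists_subset_tightly_contained {F V : Type*} [Field F] [Fintype F] [AddCommGroup V]
    [Module F V] [Fintype V] [DecidableEq V] (A : Finset V) {τ d : ℝ} (hτ0 : 0 < τ)
    (hτ : τ ≤ 1 / 2) (hd : 1 ≤ d) (hA : (2 : ℝ) ^ (-d) * Fintype.card V ≤ #A) :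
    ∃ A' ⊆ A, A'.Nonempty ∧
      (#A : ℝ) * Nat.card (affineSpan F (A' : Set V)).direction ≤ #A' * Fintype.card V ∧
      (Module.finrank F V : ℝ) - Module.finrank F (affineSpan F (A' : Set V)).direction ≤
        2 * 10 ^ 24 * d ^ 5 * Real.log (1 / τ) ^ 4 ∧
      (1 - τ) * Nat.card (affineSpan F (A' : Set V)).direction ≤ #(A' + A') := by
  classical
  set L : ℝ := Real.log (1 / τ) with hL
  have hL1 : Real.log 2 ≤ L := Real.log_le_log (by norm_num) (by
    rw [le_div_iff₀ hτ0]; linarith)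
  have hL0 : 1 / 2 ≤ L := by linarith [Real.log_two_gt_d9]
  set N : ℝ := (Fintype.card V : ℝ) with hNdef
  have hN : 0 < N := by rw [hNdef]; exact_mod_cast Fintype.card_pos
  have ha : (0 : ℝ) < #A := (by positivity : 0 < (2 : ℝ) ^ (-d) * N).trans_le hA
  set K : ℝ := 2 * 10 ^ 24 * d ^ 4 * L ^ 4 with hK
  have hK2 : 2 ≤ K := by
    calc (2 : ℝ) ≤ 2 * 10 ^ 24 * 1 ^ 4 * (1 / 2) ^ 4 := by norm_num
      _ ≤ K := by rw [hK]; gcongr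
  have hM : ∀ W : Submodule F V, (0 : ℝ) < Nat.card W := fun W => by exact_mod_cast Nat.card_pos
  set R : V × Submodule F V → ℝ := fun P =>
    cosetCount A P.1 P.2 / Nat.card P.2 * Real.exp (Module.finrank F P.2 / K) with hR
  have : Finite (Submodule F V) :=
    Finite.of_injective (fun W : Submodule F V => (W : Set V)) SetLike.coe_injective
  obtain ⟨⟨θ, W⟩, hmax⟩ := Finite.exists_max R
  have hmax' : ∀ θ' (W' : Submodule F V), cosetCount A θ' W' / Nat.card W' *
      Real.exp (Module.finrank F W' / K) ≤ cosetCount A θ W / Nat.card W *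
      Real.exp (Module.finrank F W / K) := fun θ' W' => hmax (θ', W')
  clear hmax
  clear_value R
  set A' : Finset V := A.filter (fun x => x - θ ∈ W) with hA'
  have hA'A : A' ⊆ A := Finset.filter_subset _ _
  have hA'mem : ∀ x ∈ A', x - θ ∈ W := fun x hx => (Finset.mem_filter.1 hx).2
  have hcount : cosetCount A θ W = #A' := by
    rw [cosetCount, hA', Finset.card_filter]
    push_cast
    exact Finset.sum_congr rfl fun x _ => by simp [ind, Set.indicator_apply]
  rw [hcount] at hmax'
  have hwhole : (#A : ℝ) / N * Real.exp ((Module.finrank F V - Module.finrank F W) / K) ≤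
      #A' / Nat.card W := by
    have h := hmax' 0 ⊤
    rw [cosetCount_eq_card (fun _ _ => Submodule.mem_top), finrank_top] at h
    have h2 : (Nat.card (⊤ : Submodule F V) : ℝ) = N := by
      rw [hNdef, ← Nat.card_eq_fintype_card]
      exact_mod_cast Nat.card_congr (Submodule.topEquiv (R := F) (M := V)).toEquiv
    rw [h2] at h
    rw [sub_div, Real.exp_sub, ← mul_div_assoc]
    rwa [div_le_iff₀ (Real.exp_pos _)]
  have hfinW : (Module.finrank F W : ℝ) ≤ Module.finrank F V := by
    exact_mod_cast Submodule.finrank_le W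
  have hdens : (#A : ℝ) / N ≤ #A' / Nat.card W := by
    refine le_trans (le_mul_of_one_le_right (by positivity) ?_) hwhole
    apply Real.one_le_exp
    have : (0 : ℝ) ≤ Module.finrank F V - Module.finrank F W := by linarith
    positivity
  have ha' : (0 : ℝ) < #A' := by
    have : (0 : ℝ) < #A' / Nat.card W := (by positivity : 0 < (#A : ℝ) / N).trans_le hdens
    exact (div_pos_iff_of_pos_right (hM W)).1 this
  have hA'ne : A'.Nonempty := Finset.card_pos.1 (by exact_mod_cast ha')
  have hα : (2 : ℝ) ^ (-d) ≤ #A / N := by rwa [le_div_iff₀ hN]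
  have hcard : ∀ U : Submodule F V, (Nat.card U : ℝ) = (Fintype.card F : ℝ) ^ Module.finrank F U :=
    fun U => by
      rw [Nat.card_eq_fintype_card]
      exact_mod_cast Module.card_eq_pow_finrank (K := F) (V := U)
  have hdir : (affineSpan F (A' : Set V)).direction = W := by
    set U := (affineSpan F (A' : Set V)).direction with hU
    have hUW : U ≤ W := by
      rw [hU, direction_affineSpan, vectorSpan_def, Submodule.span_le]
      rintro _ ⟨x, hx, y, hy, rfl⟩
      have := W.sub_mem (hA'mem x hx) (hA'mem y hy)
      simpa using this
    by_contra hne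
    have hlt := Submodule.finrank_lt_finrank_of_lt (lt_of_le_of_ne hUW hne)
    obtain ⟨j, hj⟩ := Nat.exists_eq_add_of_lt hlt
    obtain ⟨x₀, hx₀⟩ := hA'ne
    have h1 := hmax' x₀ U
    have h2 : (#A' : ℝ) ≤ cosetCount A x₀ U := by
      refine le_trans (le_of_eq (cosetCount_eq_card fun x hx => ?_).symm) (cosetCount_mono hA'A _ _)
      rw [hU, direction_affineSpan]
      exact vsub_mem_vectorSpan F hx hx₀
    have h3 : (#A' : ℝ) / Nat.card U * Real.exp (Module.finrank F U / K) ≤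
        #A' / Nat.card W * Real.exp (Module.finrank F W / K) :=
      le_trans (by gcongr) h1
    have hq : (2 : ℝ) ≤ Fintype.card F := by exact_mod_cast Fintype.one_lt_card
    have hq0 : (0 : ℝ) < Fintype.card F := by linarith
    have h4 : Real.exp (Module.finrank F W / K) =
        Real.exp (Module.finrank F U / K) * Real.exp (1 / K) ^ (j + 1) := by
      rw [← Real.exp_nat_mul, ← Real.exp_add, hj]
      congr 1
      push_cast
      ring
    have h5 : (Nat.card W : ℝ) = Nat.card U * (Fintype.card F : ℝ) ^ (j + 1) := by
      rw [hcard, hcard, hj, add_assoc, pow_add]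
    have h6 : Real.exp (1 / K) ^ (j + 1) < (Fintype.card F : ℝ) ^ (j + 1) := by
      refine pow_lt_pow_left₀ (lt_of_lt_of_le (exp_lt_two_of_le_half ?_) hq) (Real.exp_pos _).le
        (Nat.succ_ne_zero j)
      exact one_div_le_one_div_of_le (by norm_num) hK2
    have h7 : (#A' : ℝ) / Nat.card W * Real.exp (Module.finrank F W / K) <
        #A' / Nat.card U * Real.exp (Module.finrank F U / K) := by
      have hMU := hM U
      rw [h4, h5]
      calc (#A' : ℝ) / (Nat.card U * (Fintype.card F : ℝ) ^ (j + 1)) *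
          (Real.exp (Module.finrank F U / K) * Real.exp (1 / K) ^ (j + 1))
          = #A' / Nat.card U * Real.exp (Module.finrank F U / K) *
            (Real.exp (1 / K) ^ (j + 1) / (Fintype.card F : ℝ) ^ (j + 1)) := by
            field_simp
        _ < #A' / Nat.card U * Real.exp (Module.finrank F U / K) * 1 := by
            gcongr
            rwa [div_lt_one (by positivity)]
        _ = _ := mul_one _
    linarith
  refine ⟨A', hA'A, hA'ne, ?_, ?_, ?_⟩
  · rw [hdir]
    rwa [div_le_div_iff₀ hN (hM W)] at hdens
  · rw [hdir]
    have h1 : (#A' : ℝ) / Nat.card W ≤ 1 := by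
      rw [div_le_one (hM W), ← hcount, cosetCount, ← sum_ind_submodule,
        ← Equiv.sum_comp (Equiv.subRight θ)]
      exact Finset.sum_le_sum_of_subset_of_nonneg (Finset.subset_univ _)
        fun _ _ _ => ind_nonneg _ _
    have h2 : (2 : ℝ) ^ (-d) * Real.exp ((Module.finrank F V - Module.finrank F W) / K) ≤ 1 :=
      (mul_le_mul_of_nonneg_right hα (Real.exp_pos _).le).trans (hwhole.trans h1)
    rw [Real.rpow_def_of_pos (by norm_num), ← Real.exp_add, Real.exp_le_one_iff] at h2
    have h3 : ((Module.finrank F V : ℝ) - Module.finrank F W) / K ≤ d := by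
      have : Real.log 2 * d ≤ 1 * d := by gcongr; linarith [Real.log_two_lt_d9]
      linarith
    rw [div_le_iff₀ (by linarith)] at h3
    calc _ ≤ d * K := h3
      _ = _ := by rw [hK]; ring
  · rw [hdir]
    by_contra! hcon
    set A₁ : Finset W := Finset.univ.filter (fun w => θ + (w : V) ∈ A) with hA₁
    have hA₁card : #A₁ = #A' := by
      refine Finset.card_bij' (fun w _ => θ + (w : V)) (fun x hx => ⟨x - θ, hA'mem x hx⟩)
        ?_ ?_ ?_ ?_
      · intro w hw
        have := (Finset.mem_filter.1 hw).2
        exact Finset.mem_filter.2 ⟨this, by simp⟩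
      · intro x hx
        simpa [hA₁] using hA'A hx
      · intro w _
        simp
      · intro x _
        simp
    have hsum : #(A₁ + A₁) ≤ #(A' + A') := by
      refine Finset.card_le_card_of_injOn (fun w => θ + θ + (w : V)) ?_ ?_
      · intro w hw
        obtain ⟨x, hx, y, hy, rfl⟩ := Finset.mem_add.1 hw
        have hx' := (Finset.mem_filter.1 hx).2
        have hy' := (Finset.mem_filter.1 hy).2
        refine Finset.mem_add.2 ⟨θ + x, Finset.mem_filter.2 ⟨hx', by simp⟩, θ + y,
          Finset.mem_filter.2 ⟨hy', by simp⟩, ?_⟩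
        push_cast
        abel
      · intro w _ w' _ h
        exact Subtype.ext (add_left_cancel h)
    have hW : (Fintype.card W : ℝ) = Nat.card W := by rw [Nat.card_eq_fintype_card]
    obtain ⟨W₁, θ₁, hcodim, hinc⟩ := exists_density_increment (F := F) A₁ hτ0 hτ hd
      (by rw [hW, hA₁card, ← le_div_iff₀ (hM W)]; exact hα.trans hdens)
      (by rw [hW]; exact le_trans (by exact_mod_cast hsum) hcon.le)
    rw [hW, hA₁card, sum_ind_submodule] at hinc
    have h1 := hmax' (θ + θ₁) (W₁.map W.subtype)
    have h2 : Module.finrank F (W₁.map W.subtype) = Module.finrank F W₁ :=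
      Submodule.finrank_map_subtype_eq W W₁
    have h3 : (Nat.card (W₁.map W.subtype) : ℝ) = Nat.card W₁ := by
      rw [hcard, h2, Nat.card_eq_fintype_card]
      exact_mod_cast (Module.card_eq_pow_finrank (K := F) (V := W₁)).symm
    have h4 : ∑ x ∈ A₁, ind (W₁ : Set W) (x - θ₁) ≤ cosetCount A (θ + θ₁) (W₁.map W.subtype) := by
      have hinj : Function.Injective (fun w : W => θ + (w : V)) := fun w w' h =>
        Subtype.ext (add_left_cancel h)
      have : ∑ x ∈ A₁, ind (W₁ : Set W) (x - θ₁) =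
          cosetCount (A₁.map ⟨_, hinj⟩) (θ + θ₁) (W₁.map W.subtype) := by
        rw [cosetCount, Finset.sum_map]
        refine Finset.sum_congr rfl fun w _ => ?_
        have : θ + (w : V) - (θ + θ₁) = ((w - θ₁ : W) : V) := by
          push_cast; abel
        simp only [Function.Embedding.coeFn_mk, this]
        by_cases hw : w - θ₁ ∈ W₁
        · rw [ind_of_mem (A := (W₁ : Set W)) hw, ind_of_mem]
          exact ⟨_, hw, rfl⟩
        · rw [ind_of_notMem (A := (W₁ : Set W)) hw, ind_of_notMem]
          rintro ⟨u, hu, hu'⟩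
          exact hw ((Subtype.ext hu' : u = w - θ₁) ▸ hu)
      rw [this]
      refine cosetCount_mono (fun x hx => ?_) _ _
      obtain ⟨w, hw, rfl⟩ := Finset.mem_map.1 hx
      exact (Finset.mem_filter.1 hw).2
    have hM₁ : (0 : ℝ) < Nat.card W₁ := by exact_mod_cast Nat.card_pos
    rw [h2, h3] at h1
    have h5 : 106 / 100 * ((#A' : ℝ) / Nat.card W) * Real.exp (Module.finrank F W₁ / K) ≤
        #A' / Nat.card W * Real.exp (Module.finrank F W / K) := by
      refine le_trans ?_ h1
      gcongr
      rw [le_div_iff₀ hM₁]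
      exact hinc.trans h4
    have h6 : Real.exp (Module.finrank F W / K) ≤
        Real.exp (1 / 20) * Real.exp (Module.finrank F W₁ / K) := by
      rw [← Real.exp_add]
      apply Real.exp_le_exp.2
      rw [← sub_le_iff_le_add, ← sub_div, div_le_iff₀ (by linarith)]
      refine hcodim.trans (le_of_eq ?_)
      rw [hK]; ring
    have h7 : Real.exp (1 / 20) < 106 / 100 := by
      have := Real.exp_bound_div_one_sub_of_interval' (x := 1 / 20) (by norm_num) (by norm_num)
      norm_num at this ⊢
      linarith
    have hρ : 0 < (#A' : ℝ) / Nat.card W := div_pos ha' (hM W)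
    have h8 := Real.exp_pos (Module.finrank F W₁ / K)
    have h9 : (#A' : ℝ) / Nat.card W * Real.exp (Module.finrank F W / K) <
        106 / 100 * ((#A' : ℝ) / Nat.card W) * Real.exp (Module.finrank F W₁ / K) := by
      calc _ ≤ (#A' : ℝ) / Nat.card W *
            (Real.exp (1 / 20) * Real.exp (Module.finrank F W₁ / K)) := by gcongr
        _ < (#A' : ℝ) / Nat.card W * (106 / 100 * Real.exp (Module.finrank F W₁ / K)) := by gcongr
        _ = _ := by ring
    linarith

end Auxiliary

/-- A large subset tightly contained in its own affine span. -/
theorem large_subset_tightly_contained_in_span :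
    ∃ C : ℝ, 1 ≤ C ∧ ∀ (F : Type) [Field F] [Fintype F] [DecidableEq F] (n : ℕ), 1 ≤ n →
      ∀ τ : ℝ, 0 < τ → τ ≤ 1/2 → ∀ d : ℝ, 1 ≤ d → ∀ A : Finset (Fin n → F),
      (2:ℝ) ^ (-d) * (Fintype.card F : ℝ) ^ n ≤ A.card →
      ∃ A' : Finset (Fin n → F), A' ⊆ A ∧ A'.Nonempty ∧
        -- (i) the density of A' in its span is at least the density of A in the whole space
        (A.card : ℝ) *
            (affineSpan F (A' : Set (Fin n → F)) : Set (Fin n → F)).ncard ≤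
          (A'.card : ℝ) * (Fintype.card F : ℝ) ^ n ∧
        -- (ii) the codimension of Span*(A') is at most C · d^5 · (log(1/τ))^4
        ((n : ℝ) - Module.finrank F (affineSpan F (A' : Set (Fin n → F))).direction) ≤
          C * d ^ 5 * Real.log (1/τ) ^ 4 ∧
        -- (iii) |A' + A'| ≥ (1 − τ)·|Span*(A')|
        (1 - τ) * (affineSpan F (A' : Set (Fin n → F)) : Set (Fin n → F)).ncard ≤
          ((A' + A').card : ℝ) := by
  refine ⟨2 * 10 ^ 24, by norm_num, fun F _ _ _ n _ τ hτ0 hτ d hd A hA => ?_⟩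
  have hcard : (Fintype.card (Fin n → F) : ℝ) = (Fintype.card F : ℝ) ^ n := by simp
  obtain ⟨A', hA'A, hne, h1, h2, h3⟩ := exists_subset_tightly_contained (F := F) A hτ0 hτ hd
    (by rwa [hcard])
  obtain ⟨x, hx⟩ := hne
  rw [← ncard_affineSubspace_eq_card_direction _ (subset_affineSpan F _ hx)] at h1 h3
  rw [hcard] at h1
  rw [Module.finrank_fin_fun] at h2
  exact ⟨A', hA'A, ⟨x, hx⟩, h1, h2, h3⟩
end
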